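/- arXiv:2308.14863 — 4 statements merged into one kernel-verified Lean document; each statement's English description precedes it below -/
import Mathlib

section
/- Let n be a positive integer, K > 0, and let F ⊆ 2^[n]. If for every F ∈ F the family U_F(F) = {G \ F : G ∈ F, F ⊆ G} of subsets of [n] \ F satisfies λ_{n−|F|}(U_F(F)) ≤ K, then λ_n(F) ≤ K. -/
open Finset

/-- The Lubell mass of a family `G` of subsets of an `m`-element set:
`λ_m(G) = ∑_{A ∈ G} 1 / C(m,|A|)`. -/
noncomputable def lubell (m : ℕ) (G : Finset (Finset ℕ)) : ℝ :=
  ∑ A ∈ G, (1 : ℝ) / (m.choose A.card : ℝ)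

/-- The Lubell mass of the link `{G \ B : G ∈ F, B ⊆ G}`, as a sum over the members of `F`
containing `B`. -/
theorem lubell_image_sdiff (m : ℕ) (F : Finset (Finset ℕ)) (B : Finset ℕ) :
    lubell m ((F.filter fun G => B ⊆ G).image fun G => G \ B) =
      ∑ G ∈ F with B ⊆ G, (1 : ℝ) / (m.choose (G \ B).card : ℝ) := by
  unfold lubell
  refine Finset.sum_image fun G hG H hH h => ?_
  have hG' : B ⊆ G := (Finset.mem_filter.1 hG).2
  have hH' : B ⊆ H := (Finset.mem_filter.1 hH).2
  rw [← Finset.sdiff_union_of_subset hG', ← Finset.sdiff_union_of_subset hH']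
  exact congrArg (· ∪ B) h

theorem one_div_choose_succ_succ {m k : ℕ} (hk : k ≤ m) :
    (m + 1 : ℝ) * (1 / ((m + 1).choose (k + 1) : ℝ)) = (k + 1) * (1 / (m.choose k : ℝ)) := by
  have h : ((m + 1 : ℕ) : ℝ) * (m.choose k : ℝ) =
      ((m + 1).choose (k + 1) : ℝ) * ((k + 1 : ℕ) : ℝ) := by
    exact_mod_cast Nat.add_one_mul_choose_eq m k
  have h₁ : (m.choose k : ℝ) ≠ 0 := by exact_mod_cast (Nat.choose_pos hk).ne'
  have h₂ : ((m + 1).choose (k + 1) : ℝ) ≠ 0 := by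
    exact_mod_cast (Nat.choose_pos (Nat.succ_le_succ hk)).ne'
  push_cast at h
  field_simp
  linarith

/-- If `B` is not in `F`, the Lubell mass of the link of `F` at `B` is the average of the Lubell
masses of the links at the sets `insert x B`, `x ∈ S \ B`. -/
theorem card_mul_sum_link_eq_sum_insert {S B : Finset ℕ} {F : Finset (Finset ℕ)} {m : ℕ}
    (hF : F ⊆ S.powerset) (hBF : B ∉ F) (hm : (S \ B).card = m + 1) :
    (m + 1 : ℝ) * ∑ G ∈ F with B ⊆ G, (1 : ℝ) / ((m + 1).choose (G \ B).card : ℝ) =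
      ∑ x ∈ S \ B, ∑ G ∈ F with insert x B ⊆ G,
        (1 : ℝ) / (m.choose (G \ insert x B).card : ℝ) := by
  have swap : (∑ x ∈ S \ B, ∑ G ∈ F with insert x B ⊆ G,
        (1 : ℝ) / (m.choose (G \ insert x B).card : ℝ)) =
      ∑ G ∈ F with B ⊆ G, ∑ x ∈ G \ B, (1 : ℝ) / (m.choose (G \ insert x B).card : ℝ) := by
    refine Finset.sum_comm' fun x G => ?_
    simp only [Finset.mem_filter, Finset.mem_sdiff, Finset.insert_subset_iff]
    constructor
    · rintro ⟨⟨-, hxB⟩, hG, hx, hBG⟩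
      exact ⟨⟨hx, hxB⟩, hG, hBG⟩
    · rintro ⟨⟨hx, hxB⟩, hG, hBG⟩
      exact ⟨⟨Finset.mem_powerset.1 (hF hG) hx, hxB⟩, hG, hx, hBG⟩
  rw [swap, Finset.mul_sum]
  refine Finset.sum_congr rfl fun G hG => ?_
  obtain ⟨hGF, hBG⟩ := Finset.mem_filter.1 hG
  have hGS : G ⊆ S := Finset.mem_powerset.1 (hF hGF)
  have hpos : 0 < (G \ B).card := by
    rw [Finset.card_pos, Finset.sdiff_nonempty]
    intro hGB
    exact hBF (Finset.Subset.antisymm hBG hGB ▸ hGF)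
  obtain ⟨k, hk⟩ := Nat.exists_eq_succ_of_ne_zero hpos.ne'
  have hkm : k ≤ m := by
    have := Finset.card_le_card (Finset.sdiff_subset_sdiff hGS (Finset.Subset.refl B))
    omega
  have hcard : ∀ x ∈ G \ B, (G \ insert x B).card = k := fun x hx => by
    rw [Finset.sdiff_insert, Finset.card_erase_of_mem hx, hk, Nat.succ_sub_one]
  rw [Finset.sum_congr rfl fun x hx => by rw [hcard x hx], Finset.sum_const, hk, nsmul_eq_mul,
    one_div_choose_succ_succ hkm, Nat.cast_succ]

/-- If the links of `F` at its members have Lubell mass at most `K`, then so do the links at all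
subsets of the ground set. -/
theorem sum_link_le_of_forall_mem {S : Finset ℕ} {F : Finset (Finset ℕ)} {K : ℝ} (hK : 0 ≤ K)
    (hF : F ⊆ S.powerset)
    (hU : ∀ A ∈ F, ∑ G ∈ F with A ⊆ G,
      (1 : ℝ) / ((S \ A).card.choose (G \ A).card : ℝ) ≤ K) (m : ℕ) :
    ∀ B ⊆ S, (S \ B).card = m →
      ∑ G ∈ F with B ⊆ G, (1 : ℝ) / (m.choose (G \ B).card : ℝ) ≤ K := by
  induction m with
  | zero =>
    intro B hB hm
    by_cases hBF : B ∈ F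
    · simpa only [hm] using hU B hBF
    have hSB : S ⊆ B := Finset.sdiff_eq_empty_iff_subset.1 (Finset.card_eq_zero.1 hm)
    rw [Finset.sum_eq_zero]
    · exact hK
    intro G hG
    obtain ⟨hGF, hBG⟩ := Finset.mem_filter.1 hG
    have hGB : G ⊆ B := (Finset.mem_powerset.1 (hF hGF)).trans hSB
    exact absurd (Finset.Subset.antisymm hBG hGB ▸ hGF) hBF
  | succ m ih =>
    intro B hB hm
    by_cases hBF : B ∈ F
    · simpa only [hm] using hU B hBF
    have hpos : (0 : ℝ) < m + 1 := by positivity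
    refine le_of_mul_le_mul_left ?_ hpos
    rw [card_mul_sum_link_eq_sum_insert hF hBF hm]
    refine (Finset.sum_le_card_nsmul _ _ K fun x hx => ?_).trans_eq ?_
    · refine ih _ (Finset.insert_subset (Finset.mem_sdiff.1 hx).1 hB) ?_
      rw [Finset.sdiff_insert, Finset.card_erase_of_mem hx, hm, Nat.add_sub_cancel]
    · rw [hm, nsmul_eq_mul, Nat.cast_succ]

/-- If for every `A ∈ F` the family
`U_F(A) = {G \ A : G ∈ F, A ⊆ G}` of subsets of the `(n - |A|)`-element set `[n] \ A`
satisfies `λ_{n-|A|}(U_F(A)) ≤ K`, then `λ_n(F) ≤ K`. -/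
theorem stmt_6 (n : ℕ) (hn : 0 < n) (K : ℝ) (hK : 0 < K) (F : Finset (Finset ℕ))
    (hF : F ⊆ (Finset.range n).powerset)
    (hU : ∀ A ∈ F,
      lubell (n - A.card) (((F.filter fun G => A ⊆ G).image fun G => G \ A)) ≤ K) :
    lubell n F ≤ K := by
  have hcard : ∀ A ∈ F, (Finset.range n \ A).card = n - A.card := fun A hA => by
    rw [Finset.card_sdiff_of_subset (Finset.mem_powerset.1 (hF hA)), Finset.card_range]
  have hlink := sum_link_le_of_forall_mem hK.le hF
    (fun A hA => by rw [hcard A hA, ← lubell_image_sdiff]; exact hU A hA) n ∅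
    (Finset.empty_subset _) (by simp)
  simpa [lubell] using hlink
end

section
/- For every ε > 0 there is N such that for all n ≥ N the following holds. Let F ⊆ 2^[n] be a family all of whose members have size in the interval [n/2 − n^{2/3}, n/2 + n^{2/3}]. If for every F ∈ F we have ∇^1_F(F) ≤ εn and ∇^j_F(F) ≤ εn² for all j ≥ 2, then |F| ≤ (1+15ε)·C(n,⌊n/2⌋). -/
open Finset

/-- `∇^j_F(A)`: the number of `G ∈ F` with `A ⊆ G` and `|G| = |A| + j`. -/
def nabla (F : Finset (Finset ℕ)) (A : Finset ℕ) (j : ℕ) : ℕ :=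
  (F.filter fun G => A ⊆ G ∧ G.card = A.card + j).card

/-- The expected number of members of `F` containing `A` on a uniformly random maximal chain
from `A` to an `n`-element ground set. -/
noncomputable def chainWeight (n : ℕ) (F : Finset (Finset ℕ)) (A : Finset ℕ) : ℝ :=
  ∑ G ∈ F with A ⊆ G, ((n - A.card).choose (G.card - A.card) : ℝ)⁻¹

/-- If `A ∉ F`, the chain weight of `A` is the average of those of the sets covering `A`. -/
theorem chainWeight_eq_average {n : ℕ} {F : Finset (Finset ℕ)} (hF : F ⊆ (range n).powerset)
    {A : Finset ℕ} (hAF : A ∉ F) :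
    (n - A.card : ℕ) * chainWeight n F A =
      ∑ x ∈ range n \ A, chainWeight n F (insert x A) := by
  have key : ∀ G ∈ F, A ⊆ G →
      (n - A.card : ℕ) * ((n - A.card).choose (G.card - A.card) : ℝ)⁻¹ =
        (G \ A).card * ((n - (A.card + 1)).choose (G.card - (A.card + 1)) : ℝ)⁻¹ := by
    intro G hG hAG
    have hGn : G ⊆ range n := mem_powerset.1 (hF hG)
    have h1 : A.card < G.card := card_lt_card (hAG.ssubset_of_ne (by rintro rfl; exact hAF hG))
    have h2 : G.card ≤ n := by simpa using card_le_card hGn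
    rw [card_sdiff_of_subset hAG]
    obtain ⟨k, hk⟩ : ∃ k, G.card = A.card + 1 + k := ⟨_, (Nat.add_sub_of_le h1).symm⟩
    obtain ⟨m, hm⟩ : ∃ m, n = A.card + 1 + m := ⟨_, (Nat.add_sub_of_le (by omega)).symm⟩
    have e1 : n - A.card = m + 1 := by omega
    have e2 : G.card - A.card = k + 1 := by omega
    have e3 : n - (A.card + 1) = m := by omega
    have e4 : G.card - (A.card + 1) = k := by omega
    rw [e1, e2, e3, e4]
    have p1 : (0 : ℝ) < (m + 1).choose (k + 1) := by
      exact_mod_cast Nat.choose_pos (by omega)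
    have p2 : (0 : ℝ) < m.choose k := by exact_mod_cast Nat.choose_pos (by omega)
    have := Nat.add_one_mul_choose_eq m k
    rw [← div_eq_mul_inv, ← div_eq_mul_inv, div_eq_div_iff p1.ne' p2.ne']
    rw [mul_comm ((k + 1 : ℕ) : ℝ)]
    exact_mod_cast this
  unfold chainWeight
  simp only [sum_filter, mul_sum]
  rw [sum_comm]
  refine sum_congr rfl fun G hG => ?_
  by_cases hAG : A ⊆ G
  · rw [if_pos hAG, key G hG hAG]
    have hGn : G ⊆ range n := mem_powerset.1 (hF hG)
    have : ∀ x ∈ range n \ A,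
        (if insert x A ⊆ G then
          ((n - (insert x A).card).choose (G.card - (insert x A).card) : ℝ)⁻¹ else 0) =
        if x ∈ G \ A then ((n - (A.card + 1)).choose (G.card - (A.card + 1)) : ℝ)⁻¹ else 0 := by
      intro x hx
      have hxA := (mem_sdiff.1 hx).2
      simp [insert_subset_iff, hAG, hxA, card_insert_of_notMem hxA]
    rw [sum_congr rfl this, ← sum_filter, sum_const, nsmul_eq_mul]
    congr 3
    ext x
    simp only [mem_filter, mem_sdiff]
    exact ⟨fun h => ⟨⟨hGn h.1, h.2⟩, h⟩, fun h => h.2⟩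
  · rw [if_neg hAG, mul_zero]
    refine (sum_eq_zero fun x _ => if_neg fun h => hAG ((subset_insert x A).trans h)).symm

/-- A bound on the chain weights of the members of `F` holds for all sets. -/
theorem chainWeight_le {n : ℕ} {F : Finset (Finset ℕ)} (hF : F ⊆ (range n).powerset) {c : ℝ}
    (hc : 0 ≤ c) (h : ∀ A ∈ F, chainWeight n F A ≤ c) {A : Finset ℕ} (hA : A ⊆ range n) :
    chainWeight n F A ≤ c := by
  induction hk : n - A.card generalizing A with
  | zero =>
    by_cases hAF : A ∈ F
    · exact h A hAF
    have hAn : A = range n := eq_of_subset_of_card_le hA (by rw [card_range]; omega)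
    refine le_of_eq_of_le (sum_eq_zero fun G hG => ?_) hc
    obtain ⟨hG, hAG⟩ := mem_filter.1 hG
    refine absurd ?_ hAF
    rwa [(hAn ▸ mem_powerset.1 (hF hG) : G ⊆ A).antisymm hAG] at hG
  | succ k ih =>
    by_cases hAF : A ∈ F
    · exact h A hAF
    have havg := chainWeight_eq_average hF hAF
    have hsum : ∑ x ∈ range n \ A, chainWeight n F (insert x A) ≤ (n - A.card : ℕ) * c := by
      refine (sum_le_card_nsmul _ _ c fun x hx => ?_).trans_eq ?_
      · obtain ⟨hx, hxA⟩ := mem_sdiff.1 hx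
        exact ih (insert_subset hx hA) (by rw [card_insert_of_notMem hxA]; omega)
      · rw [card_sdiff_of_subset hA, card_range, nsmul_eq_mul]
    rw [← havg] at hsum
    exact le_of_mul_le_mul_left hsum (by rw [hk]; positivity)

theorem card_le_chainWeight_empty_mul {n : ℕ} {F : Finset (Finset ℕ)}
    (hF : F ⊆ (range n).powerset) :
    (F.card : ℝ) ≤ chainWeight n F ∅ * n.choose (n / 2) := by
  simp only [chainWeight, empty_subset, filter_true, card_empty, Nat.sub_zero, sum_mul]
  rw [card_eq_sum_ones, Nat.cast_sum]
  refine sum_le_sum fun G hG => ?_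
  have hGn : G.card ≤ n := by simpa using card_le_card (mem_powerset.1 (hF hG))
  have hpos : (0 : ℝ) < n.choose G.card := by exact_mod_cast Nat.choose_pos hGn
  rw [Nat.cast_one, inv_mul_eq_div, one_le_div hpos]
  exact_mod_cast Nat.choose_le_middle _ _

theorem chainWeight_eq_sum_nabla {n L : ℕ} {F : Finset (Finset ℕ)} {A : Finset ℕ}
    (hL : ∀ G ∈ F, G.card ≤ A.card + L) :
    chainWeight n F A =
      ∑ j ∈ range (L + 1), (nabla F A j : ℝ) * ((n - A.card).choose j : ℝ)⁻¹ := by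
  unfold chainWeight
  rw [← sum_fiberwise_of_maps_to (t := range (L + 1)) (g := fun G => G.card - A.card)]
  · refine sum_congr rfl fun j _ => ?_
    have : {G ∈ {G ∈ F | A ⊆ G} | G.card - A.card = j} =
        F.filter fun G => A ⊆ G ∧ G.card = A.card + j := by
      ext G
      simp only [mem_filter, and_assoc]
      refine and_congr_right fun _ => and_congr_right fun hAG => ?_
      have := card_le_card hAG
      omega
    rw [this, nabla, ← nsmul_eq_mul]
    refine sum_eq_card_nsmul fun G hG => ?_
    rw [(mem_filter.1 hG).2.2, Nat.add_sub_cancel_left]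
  · intro G hG
    have := hL G (mem_filter.1 hG).1
    rw [mem_range]
    omega

theorem nabla_zero_le_one (F : Finset (Finset ℕ)) (A : Finset ℕ) : nabla F A 0 ≤ 1 := by
  refine card_le_one.2 fun G hG H hH => ?_
  obtain ⟨-, h1, h2⟩ := mem_filter.1 hG
  obtain ⟨-, h3, h4⟩ := mem_filter.1 hH
  rw [← eq_of_subset_of_card_le h1 h2.le, ← eq_of_subset_of_card_le h3 h4.le]

theorem choose_three_le_choose {m j : ℕ} (hj : 3 ≤ j) (hm : 2 * j ≤ m) :
    m.choose 3 ≤ m.choose j := by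
  induction j, hj using Nat.le_induction with
  | base => rfl
  | succ k _ ih => exact (ih (by omega)).trans (Nat.choose_le_succ_of_lt_half_left (by omega))

/-- The chain weight of a set near the middle layer, in terms of bounds on its up-degrees. -/
theorem chainWeight_le_of_nabla_le {n : ℕ} (hn : 1000 ≤ n) {ε : ℝ} (hε : 0 ≤ ε)
    {F : Finset (Finset ℕ)} {A : Finset ℕ} (hA : (A.card : ℝ) ≤ n / 2 + n / 100)
    (hF : ∀ G ∈ F, (G.card : ℝ) ≤ A.card + n / 50) (h1 : (nabla F A 1 : ℝ) ≤ ε * n)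
    (h2 : ∀ j : ℕ, 2 ≤ j → (nabla F A j : ℝ) ≤ ε * (n : ℝ) ^ 2) :
    chainWeight n F A ≤ 1 + 15 * ε := by
  have hn' : (1000 : ℝ) ≤ n := by exact_mod_cast hn
  have hAn : A.card ≤ n := by
    have : (A.card : ℝ) ≤ n := by linarith
    exact_mod_cast this
  obtain ⟨L, hL⟩ : ∃ L, n / 50 = L + 2 := ⟨n / 50 - 2, by omega⟩
  have hLn : 50 * ((L : ℝ) + 2) ≤ n := by
    have : 50 * (L + 2) ≤ n := by omega
    exact_mod_cast this
  rw [chainWeight_eq_sum_nabla (L := L + 2)]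
  swap
  · intro G hG
    have h50 : (50 * G.card : ℝ) ≤ 50 * A.card + n := by linarith [hF G hG]
    have : 50 * G.card ≤ 50 * A.card + n := by exact_mod_cast h50
    omega
  obtain ⟨m, hm⟩ : ∃ m, n - A.card = m := ⟨_, rfl⟩
  have hmn : (m : ℝ) = n - A.card := by rw [← hm, Nat.cast_sub hAn]
  have hm49 : 49 / 100 * (n : ℝ) ≤ m := by linarith
  have hmL : 2 * (L + 2) ≤ m := by
    have : 2 * ((L : ℝ) + 2) ≤ m := by linarith
    exact_mod_cast this
  rw [hm]
  have b0 : (nabla F A 0 : ℝ) * (m.choose 0 : ℝ)⁻¹ ≤ 1 := by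
    simpa using nabla_zero_le_one F A
  have b1 : (nabla F A 1 : ℝ) * (m.choose 1 : ℝ)⁻¹ ≤ 3 * ε := by
    rw [Nat.choose_one_right, ← div_eq_mul_inv, div_le_iff₀ (by linarith)]
    nlinarith
  have b2 : (nabla F A 2 : ℝ) * (m.choose 2 : ℝ)⁻¹ ≤ 9 * ε := by
    have hc : (n : ℝ) ^ 2 ≤ 9 * m.choose 2 := by
      rw [Nat.cast_choose_two]
      have : (49 / 100 * (n : ℝ)) * (48 / 100 * n) ≤ m * (m - 1) := by
        gcongr
        linarith
      nlinarith
    rw [← div_eq_mul_inv, div_le_iff₀ (by nlinarith)]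
    nlinarith [h2 2 le_rfl]
  have b3 : ∀ j ∈ range L,
      (nabla F A (j + 1 + 1 + 1) : ℝ) * (m.choose (j + 1 + 1 + 1) : ℝ)⁻¹ ≤ 60 * ε / n := by
    intro j hj
    rw [mem_range] at hj
    have hc : (n : ℝ) ^ 3 ≤ 60 * m.choose 3 := by
      have h3 : (m.choose 3 : ℝ) * 6 = m * (m - 1) * (m - 2) := by
        obtain ⟨k, rfl⟩ : ∃ k, m = k + 3 := ⟨m - 3, by omega⟩
        have := Nat.descFactorial_eq_factorial_mul_choose (k + 3) 3
        simp only [Nat.descFactorial_succ, Nat.descFactorial_zero, Nat.factorial] at this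
        have h' : ((k + 3 - 2 : ℕ) : ℝ) * (((k + 3 - 1 : ℕ) : ℝ) * ((k + 3 : ℕ) : ℝ)) =
            6 * ((k + 3).choose 3 : ℝ) := by
          exact_mod_cast (by simpa using this)
        rw [show k + 3 - 2 = k + 1 by omega, show k + 3 - 1 = k + 2 by omega] at h'
        push_cast at h' ⊢
        linarith
      have : (49 / 100 * (n : ℝ)) * (48 / 100 * n) * (48 / 100 * n) ≤ m * (m - 1) * (m - 2) := by
        gcongr
        · nlinarith
        all_goals linarith
      nlinarith [pow_pos (by linarith : (0 : ℝ) < n) 3]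
    have hle : (m.choose 3 : ℝ) ≤ m.choose (j + 1 + 1 + 1) := by
      exact_mod_cast choose_three_le_choose (by omega) (by omega)
    have hpos : (0 : ℝ) < m.choose (j + 1 + 1 + 1) := by
      have := pow_pos (by linarith : (0 : ℝ) < n) 3
      linarith
    rw [← div_eq_mul_inv, div_le_div_iff₀ hpos (by linarith)]
    calc (nabla F A (j + 1 + 1 + 1) : ℝ) * n ≤ ε * (n : ℝ) ^ 2 * n := by
          gcongr; exact h2 _ (by omega)
      _ = ε * (n : ℝ) ^ 3 := by ring
      _ ≤ ε * (60 * m.choose (j + 1 + 1 + 1)) := by gcongr; linarith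
      _ = _ := by ring
  have bsum := sum_le_card_nsmul _ _ _ b3
  have btail : (L : ℝ) * (60 * ε / n) ≤ 2 * ε := by
    rw [← mul_div_assoc, div_le_iff₀ (by linarith)]
    nlinarith
  rw [card_range, nsmul_eq_mul] at bsum
  rw [sum_range_succ', sum_range_succ', sum_range_succ']
  linarith

theorem rpow_two_thirds_le {x : ℝ} (hx : 1000000 ≤ x) : x ^ ((2 : ℝ) / 3) ≤ x / 100 := by
  have hx0 : 0 < x := by linarith
  have h100 : (100 : ℝ) ≤ x ^ ((1 : ℝ) / 3) := by
    have : (1000000 : ℝ) ^ ((1 : ℝ) / 3) = 100 := by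
      rw [show (1000000 : ℝ) = 100 ^ (3 : ℝ) by norm_num, ← Real.rpow_mul (by norm_num)]
      norm_num
    rw [← this]
    exact Real.rpow_le_rpow (by norm_num) hx (by norm_num)
  have hmul : x ^ ((2 : ℝ) / 3) * x ^ ((1 : ℝ) / 3) = x := by
    rw [← Real.rpow_add hx0]
    norm_num
  have := Real.rpow_pos_of_pos hx0 ((2 : ℝ) / 3)
  nlinarith

/-- If all members of `F ⊆ 2^[n]` have size in
`[n/2 - n^{2/3}, n/2 + n^{2/3}]` and every `A ∈ F` satisfies `∇¹_F(A) ≤ εn` and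
`∇^j_F(A) ≤ εn²` for all `j ≥ 2`, then `|F| ≤ (1 + 15ε) C(n,⌊n/2⌋)` for large `n`. -/
theorem stmt_8 (ε : ℝ) (hε : 0 < ε) : ∃ N : ℕ, ∀ n ≥ N,
    ∀ F ⊆ (Finset.range n).powerset,
      (∀ A ∈ F, (n : ℝ) / 2 - (n : ℝ) ^ ((2 : ℝ) / 3) ≤ (A.card : ℝ) ∧
        (A.card : ℝ) ≤ (n : ℝ) / 2 + (n : ℝ) ^ ((2 : ℝ) / 3)) →
      (∀ A ∈ F, (nabla F A 1 : ℝ) ≤ ε * n ∧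
        ∀ j : ℕ, 2 ≤ j → (nabla F A j : ℝ) ≤ ε * (n : ℝ) ^ 2) →
      (F.card : ℝ) ≤ (1 + 15 * ε) * (n.choose (n / 2) : ℝ) := by
  refine ⟨1000000, fun n hn F hF hsize hdeg => ?_⟩
  have hpow := rpow_two_thirds_le (x := n) (by exact_mod_cast hn)
  have hmem : ∀ A ∈ F, chainWeight n F A ≤ 1 + 15 * ε := fun A hA =>
    chainWeight_le_of_nabla_le (by omega) hε.le (by linarith [hsize A hA])
      (fun G hG => by linarith [hsize A hA, hsize G hG]) (hdeg A hA).1 (hdeg A hA).2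
  have hempty := chainWeight_le hF (by positivity) hmem (empty_subset (range n))
  exact (card_le_chainWeight_empty_mul hF).trans (by gcongr)
end

section
/- For all integers t ≥ 1 and h ≥ 2 and every ε > 0 there exists C > 0 such that for any sequence of probabilities p = p(n) with C/n < p(n) ≤ 1, with high probability the maximum size of a P_{t,h}-free subfamily of the random family P(n,p(n)) lies between (h−1−ε)·p(n)·C(n,⌊n/2⌋) and (h−1+ε)·p(n)·C(n,⌊n/2⌋). -/
open Finset

/-- The elements of the upward monotone `t`-ary tree poset `P_{t,h}` of height `h`:
sequences over `{1,…,t}` of length at most `h - 1`, ordered by the prefix relation. -/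
def PthVert (t h : ℕ) : Type := {l : List (Fin t) // l.length ≤ h - 1}

/-- `F` contains a copy of `P_{t,h}`: an injective poset homomorphism from `P_{t,h}`
(sequences ordered by the prefix relation) into `F` (ordered by inclusion). -/
def ContainsPth (t h : ℕ) (F : Finset (Finset ℕ)) : Prop :=
  ∃ φ : PthVert t h → Finset ℕ, Function.Injective φ ∧ (∀ a, φ a ∈ F) ∧
    ∀ a b : PthVert t h, a.1 <+: b.1 → φ a ⊆ φ b

/-- `F` is `P_{t,h}`-free. -/
def PthFree (t h : ℕ) (F : Finset (Finset ℕ)) : Prop := ¬ ContainsPth t h F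

open scoped Classical in
/-- The maximum size of a `P_{t,h}`-free subfamily of `G`. -/
noncomputable def maxPthFreeSub (t h : ℕ) (G : Finset (Finset ℕ)) : ℕ :=
  (G.powerset.filter fun F => PthFree t h F).sup Finset.card

open scoped Classical in
/-- The probability that the random family `𝒫(n,p)` (each subset of `[n]` kept independently
with probability `p`) satisfies the event `E`. -/
noncomputable def probFam (n : ℕ) (p : ℝ) (E : Finset (Finset ℕ) → Prop) : ℝ :=
  ∑ F ∈ (Finset.range n).powerset.powerset.filter (fun F => E F),
    p ^ F.card * (1 - p) ^ (2 ^ n - F.card)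


/-- The expectation of `f` over a random subset of `A` that keeps each element independently
with probability `p`. -/
noncomputable def randSubsetExp {α : Type*} (p : ℝ) (A : Finset α) (f : Finset α → ℝ) : ℝ :=
  ∑ G ∈ A.powerset, p ^ #G * (1 - p) ^ (#A - #G) * f G

section RandSubsetExp

variable {α : Type*} {p : ℝ} {A : Finset α} {f g : Finset α → ℝ}

lemma randSubsetExp_mono (hp0 : 0 ≤ p) (hp1 : p ≤ 1) (h : ∀ G ⊆ A, f G ≤ g G) :
    randSubsetExp p A f ≤ randSubsetExp p A g := by
  refine Finset.sum_le_sum fun G hG => ?_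
  have : 0 ≤ 1 - p := by linarith
  exact mul_le_mul_of_nonneg_left (h G (mem_powerset.1 hG)) (by positivity)

lemma randSubsetExp_add :
    randSubsetExp p A (fun G => f G + g G) = randSubsetExp p A f + randSubsetExp p A g := by
  simp only [randSubsetExp, mul_add, Finset.sum_add_distrib]

lemma randSubsetExp_const_mul (c : ℝ) :
    randSubsetExp p A (fun G => c * f G) = c * randSubsetExp p A f := by
  simp only [randSubsetExp, Finset.mul_sum]
  exact Finset.sum_congr rfl fun G _ => by ring

lemma randSubsetExp_insert [DecidableEq α] {v : α} (hv : v ∉ A) :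
    randSubsetExp p (insert v A) f =
      (1 - p) * randSubsetExp p A f + p * randSubsetExp p A (fun G => f (insert v G)) := by
  unfold randSubsetExp
  rw [Finset.sum_powerset_insert hv, Finset.mul_sum, Finset.mul_sum]
  congr 1 <;> refine Finset.sum_congr rfl fun G hG => ?_
  · have h1 : #G ≤ #A := card_le_card (mem_powerset.1 hG)
    rw [card_insert_of_notMem hv, Nat.sub_add_comm h1]
    ring
  · have hvG : v ∉ G := fun h => hv (mem_powerset.1 hG h)
    rw [card_insert_of_notMem hv, card_insert_of_notMem hvG, Nat.add_sub_add_right]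
    ring

lemma randSubsetExp_one [DecidableEq α] : randSubsetExp p A (fun _ => 1) = 1 := by
  induction A using Finset.induction_on with
  | empty => simp [randSubsetExp]
  | insert v A hv ih => rw [randSubsetExp_insert hv, ih]; ring

lemma randSubsetExp_sdiff [DecidableEq α] (N : Finset α) :
    randSubsetExp p A (fun G => f (G \ N)) = randSubsetExp p (A \ N) f := by
  induction A using Finset.induction_on generalizing f with
  | empty => simp [randSubsetExp]
  | insert v A hv ih =>
    rw [randSubsetExp_insert hv, ih]
    by_cases hN : v ∈ N
    · simp only [insert_sdiff_of_mem _ hN, ih]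
      ring
    · simp only [insert_sdiff_of_notMem _ hN]
      rw [randSubsetExp_insert (by simp [hv]), ih (f := fun G => f (insert v G))]

lemma randSubsetExp_exp_card_inter_le [DecidableEq α] (hp0 : 0 ≤ p) (hp1 : p ≤ 1)
    (s : ℝ) (L : Finset α) :
    randSubsetExp p A (fun G => Real.exp (s * #(G ∩ L))) ≤
      Real.exp (p * (Real.exp s - 1) * #(A ∩ L)) := by
  induction A using Finset.induction_on with
  | empty => simp [randSubsetExp]
  | insert v A hv ih =>
    rw [randSubsetExp_insert hv]
    by_cases hL : v ∈ L
    · have h1 : randSubsetExp p A (fun G => Real.exp (s * #(insert v G ∩ L))) =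
          Real.exp s * randSubsetExp p A (fun G => Real.exp (s * #(G ∩ L))) := by
        rw [← randSubsetExp_const_mul]
        refine Finset.sum_congr rfl fun G hG => ?_
        have hvG : v ∉ G ∩ L := fun h => hv (mem_powerset.1 hG (mem_inter.1 h).1)
        beta_reduce
        rw [insert_inter_of_mem hL, card_insert_of_notMem hvG, ← Real.exp_add]
        push_cast
        ring_nf
      have hvA : v ∉ A ∩ L := fun h => hv (mem_inter.1 h).1
      rw [h1, insert_inter_of_mem hL, card_insert_of_notMem hvA]
      have h2 : Real.exp (p * (Real.exp s - 1) * ((#(A ∩ L) + 1 : ℕ) : ℝ)) =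
          Real.exp (p * (Real.exp s - 1)) * Real.exp (p * (Real.exp s - 1) * #(A ∩ L)) := by
        rw [← Real.exp_add]
        push_cast
        ring_nf
      rw [h2]
      have h3 := Real.add_one_le_exp (p * (Real.exp s - 1))
      have h4 : 0 ≤ 1 - p + p * Real.exp s := by
        have := Real.exp_pos s
        have : 0 ≤ p * Real.exp s := by positivity
        linarith
      calc _ = (1 - p + p * Real.exp s) *
            randSubsetExp p A (fun G => Real.exp (s * #(G ∩ L))) := by ring
        _ ≤ (1 - p + p * Real.exp s) * Real.exp (p * (Real.exp s - 1) * #(A ∩ L)) :=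
            mul_le_mul_of_nonneg_left ih h4
        _ ≤ _ := mul_le_mul_of_nonneg_right (by linarith) (Real.exp_pos _).le
    · simp only [insert_inter_of_notMem hL]
      linarith

end RandSubsetExp

/-- Every member of `F` has fewer than `T` proper supersets in `F`. -/
def UpStarFree (T : ℕ) (F : Finset (Finset ℕ)) : Prop :=
  ∀ a ∈ F, #{b ∈ F | a ⊂ b} < T

lemma UpStarFree.mono {T : ℕ} {F F' : Finset (Finset ℕ)} (h : UpStarFree T F) (hF : F' ⊆ F) :
    UpStarFree T F' := fun a ha =>
  (card_le_card (filter_subset_filter _ hF)).trans_lt (h a (hF ha))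

open scoped Classical in
/-- The maximum size of a subfamily of `G` in which every member has fewer than `T` proper
supersets. -/
noncomputable def maxUpStarFreeSub (T : ℕ) (G : Finset (Finset ℕ)) : ℕ :=
  (G.powerset.filter (UpStarFree T)).sup Finset.card

section MaxUpStarFreeSub

variable {T : ℕ} {F G : Finset (Finset ℕ)}

lemma card_le_maxUpStarFreeSub (hF : F ⊆ G) (h : UpStarFree T F) :
    #F ≤ maxUpStarFreeSub T G := by
  classical
  exact Finset.le_sup (f := Finset.card) (by simp [hF, h])

lemma maxUpStarFreeSub_le {m : ℕ} (h : ∀ F ⊆ G, UpStarFree T F → #F ≤ m) :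
    maxUpStarFreeSub T G ≤ m := by
  classical
  refine Finset.sup_le fun F hF => ?_
  simp only [mem_filter, mem_powerset] at hF
  exact h F hF.1 hF.2

lemma maxUpStarFreeSub_le_card : maxUpStarFreeSub T G ≤ #G :=
  maxUpStarFreeSub_le fun _ hF _ => card_le_card hF

lemma maxUpStarFreeSub_le_add (N : Finset (Finset ℕ)) :
    maxUpStarFreeSub T G ≤ maxUpStarFreeSub T (G \ N) + #(G ∩ N) := by
  refine maxUpStarFreeSub_le fun F hF h => ?_
  have h1 := card_le_maxUpStarFreeSub (sdiff_subset_sdiff hF (Subset.refl N)) (h.mono sdiff_subset)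
  have h2 : #(F ∩ N) ≤ #(G ∩ N) := card_le_card (inter_subset_inter_right hF)
  have h3 := card_sdiff_add_card_inter F N
  omega

lemma maxUpStarFreeSub_insert_le {v : Finset ℕ} {N : Finset (Finset ℕ)}
    (hN : ∀ b ∈ N, v ⊂ b) :
    maxUpStarFreeSub T (insert v G) ≤
      max (maxUpStarFreeSub T G) (T + maxUpStarFreeSub T (G \ N)) := by
  refine maxUpStarFreeSub_le fun F hF h => ?_
  by_cases hv : v ∈ F
  · refine le_max_of_le_right ?_
    have h1 : #((F.erase v) \ N) ≤ maxUpStarFreeSub T (G \ N) := by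
      refine card_le_maxUpStarFreeSub (sdiff_subset_sdiff ?_ (Subset.refl N))
        (h.mono (sdiff_subset.trans (erase_subset _ _)))
      rwa [← subset_insert_iff]
    have h2 : #(F.erase v ∩ N) ≤ #{b ∈ F | v ⊂ b} := by
      refine card_le_card fun b hb => ?_
      simp only [mem_inter, mem_erase] at hb
      simp [hb.1.2, hN b hb.2]
    have h3 := card_sdiff_add_card_inter (F.erase v) N
    have h4 := h v hv
    have h5 := card_erase_add_one hv
    omega
  · exact le_max_of_le_left (card_le_maxUpStarFreeSub ((subset_insert_iff_of_notMem hv).1 hF) h)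

end MaxUpStarFreeSub

/-- The exponential moment of `maxUpStarFreeSub` over a random subfamily of `A`. -/
noncomputable def upStarFreeMoment (p s : ℝ) (T : ℕ) (A : Finset (Finset ℕ)) : ℝ :=
  randSubsetExp p A fun G => Real.exp (s * maxUpStarFreeSub T G)

section UpStarFreeMoment

variable {p s : ℝ} {T : ℕ} {A V : Finset (Finset ℕ)}

lemma upStarFreeMoment_le_exp_card (hp0 : 0 ≤ p) (hp1 : p ≤ 1) (hs : 0 ≤ s) :
    upStarFreeMoment p s T A ≤ Real.exp (p * (Real.exp s - 1) * #A) := by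
  have h := randSubsetExp_exp_card_inter_le (A := A) hp0 hp1 s A
  rw [inter_self] at h
  refine (randSubsetExp_mono hp0 hp1 fun G hG => ?_).trans h
  rw [inter_eq_left.2 hG]
  have : (maxUpStarFreeSub T G : ℝ) ≤ #G := by exact_mod_cast maxUpStarFreeSub_le_card
  gcongr

lemma upStarFreeMoment_le_add (hp0 : 0 ≤ p) (hp1 : p ≤ 1) (hs : 0 ≤ s) {v : Finset ℕ}
    (hv : v ∈ A) :
    upStarFreeMoment p s T A ≤ upStarFreeMoment p s T (A.erase v) +
      p * Real.exp (s * T) * upStarFreeMoment p s T (A.erase v \ {b ∈ A | v ⊂ b}) := by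
  set N := {b ∈ A | v ⊂ b} with hN
  have h1 : randSubsetExp p (A.erase v)
      (fun G => Real.exp (s * maxUpStarFreeSub T (insert v G))) ≤
      upStarFreeMoment p s T (A.erase v) +
        Real.exp (s * T) * upStarFreeMoment p s T (A.erase v \ N) := by
    unfold upStarFreeMoment
    rw [← randSubsetExp_sdiff, ← randSubsetExp_const_mul, ← randSubsetExp_add]
    refine randSubsetExp_mono hp0 hp1 fun G _ => ?_
    rw [← Real.exp_add]
    have h2 := maxUpStarFreeSub_insert_le (T := T) (G := G) (v := v) (N := N)
      (fun b hb => (mem_filter.1 hb).2)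
    rcases le_max_iff.1 h2 with h | h
    · have h' : (maxUpStarFreeSub T (insert v G) : ℝ) ≤ maxUpStarFreeSub T G := by
        exact_mod_cast h
      have := Real.exp_le_exp.2 (mul_le_mul_of_nonneg_left h' hs)
      have := Real.exp_pos (s * T + s * maxUpStarFreeSub T (G \ N))
      linarith
    · have h' : (maxUpStarFreeSub T (insert v G) : ℝ) ≤ T + maxUpStarFreeSub T (G \ N) := by
        exact_mod_cast h
      have := Real.exp_le_exp.2 (mul_le_mul_of_nonneg_left h' hs)
      have := Real.exp_pos (s * maxUpStarFreeSub T G)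
      rw [mul_add] at *
      linarith
  have h3 : upStarFreeMoment p s T A = (1 - p) * upStarFreeMoment p s T (A.erase v) +
      p * randSubsetExp p (A.erase v)
        (fun G => Real.exp (s * maxUpStarFreeSub T (insert v G))) := by
    conv_lhs => rw [← insert_erase hv]
    exact randSubsetExp_insert (notMem_erase v A)
  rw [h3]
  have := mul_le_mul_of_nonneg_left h1 hp0
  linarith

lemma upStarFreeMoment_insert_le (hp0 : 0 ≤ p) (hp1 : p ≤ 1) (hs : 0 ≤ s) {v : Finset ℕ}
    (hv : v ∉ A) :
    upStarFreeMoment p s T (insert v A) ≤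
      upStarFreeMoment p s T A * Real.exp (p * (Real.exp s - 1)) := by
  have h1 : randSubsetExp p A (fun G => Real.exp (s * maxUpStarFreeSub T (insert v G))) ≤
      Real.exp s * upStarFreeMoment p s T A := by
    unfold upStarFreeMoment
    rw [← randSubsetExp_const_mul]
    refine randSubsetExp_mono hp0 hp1 fun G hG => ?_
    have hvG : v ∉ G := fun h => hv (hG h)
    have h2 := maxUpStarFreeSub_le_add (T := T) (G := insert v G) {v}
    rw [sdiff_singleton_eq_erase, erase_insert hvG,
      inter_singleton_of_mem (mem_insert_self v G), card_singleton] at h2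
    have h3 : (maxUpStarFreeSub T (insert v G) : ℝ) ≤ maxUpStarFreeSub T G + 1 := by
      exact_mod_cast h2
    rw [← Real.exp_add, Real.exp_le_exp]
    nlinarith
  have h4 := mul_le_mul_of_nonneg_left h1 hp0
  have h5 : 0 ≤ upStarFreeMoment p s T A := by
    have := randSubsetExp_mono (A := A) hp0 hp1
      (f := fun _ => (0 : ℝ)) (g := fun G => Real.exp (s * maxUpStarFreeSub T G))
      (fun G _ => (Real.exp_pos _).le)
    simpa [randSubsetExp, upStarFreeMoment] using this
  have h6 := mul_le_mul_of_nonneg_left (Real.add_one_le_exp (p * (Real.exp s - 1))) h5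
  have h7 := randSubsetExp_insert (p := p) (f := fun G => Real.exp (s * maxUpStarFreeSub T G)) hv
  unfold upStarFreeMoment at *
  linarith

lemma upStarFreeMoment_union_le (hp0 : 0 ≤ p) (hp1 : p ≤ 1) (hs : 0 ≤ s)
    {B : Finset (Finset ℕ)} (hAB : Disjoint A B) :
    upStarFreeMoment p s T (A ∪ B) ≤
      upStarFreeMoment p s T A * Real.exp (p * (Real.exp s - 1) * #B) := by
  induction B using Finset.induction_on with
  | empty => simp
  | insert v B hv ih =>
    rw [disjoint_insert_right] at hAB
    rw [union_insert, card_insert_of_notMem hv]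
    refine (upStarFreeMoment_insert_le hp0 hp1 hs (by simp [hAB.1, hv])).trans ?_
    refine (mul_le_mul_of_nonneg_right (ih hAB.2) (Real.exp_pos _).le).trans_eq ?_
    rw [mul_assoc, ← Real.exp_add]
    push_cast
    ring_nf

/-- If every large subfamily of `V` has a member with at least `d` proper supersets in it, then
the exponential moment grows slowly with the size of the subfamily. -/
lemma upStarFreeMoment_le_of_exists_large_degree (hp0 : 0 ≤ p) (hp1 : p ≤ 1) (hs : 0 ≤ s)
    {K d μ m : ℝ} (hK : 0 ≤ K) (hμ : 0 ≤ μ)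
    (hsmall : ∀ A ⊆ V, (#A : ℝ) ≤ m → upStarFreeMoment p s T A ≤ K)
    (hdeg : ∀ A ⊆ V, m < #A → ∃ v ∈ A, d ≤ #{b ∈ A | v ⊂ b})
    (hd : p * Real.exp (s * T) * Real.exp (-(μ * d)) ≤ μ) (hA : A ⊆ V) :
    upStarFreeMoment p s T A ≤ K * Real.exp (μ * #A) := by
  induction A using Finset.strongInduction with
  | H A ih =>
    rcases le_or_gt (#A : ℝ) m with hm | hm
    · refine (hsmall A hA hm).trans (le_mul_of_one_le_right hK (Real.one_le_exp (by positivity)))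
    · obtain ⟨v, hv, hvd⟩ := hdeg A hA hm
      set N := {b ∈ A | v ⊂ b} with hN
      have hNA : N ⊆ A.erase v := fun b hb => by
        simp only [hN, mem_filter] at hb
        exact mem_erase.2 ⟨hb.2.ne', hb.1⟩
      have h1 := ih (A.erase v) (erase_ssubset hv) ((erase_subset _ _).trans hA)
      have h2 := ih (A.erase v \ N)
        (sdiff_subset.trans_ssubset (erase_ssubset hv))
        (sdiff_subset.trans ((erase_subset _ _).trans hA))
      have c1 : (#(A.erase v) : ℝ) = #A - 1 := by
        rw [← card_erase_add_one hv]; push_cast; ring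
      have c2 : (#(A.erase v \ N) : ℝ) ≤ #A - 1 - d := by
        have : (#(A.erase v \ N) : ℝ) + #N = #(A.erase v) := by
          exact_mod_cast card_sdiff_add_card_eq_card hNA
        linarith
      have h3 := upStarFreeMoment_le_add (T := T) hp0 hp1 hs hv
      rw [← hN] at h3
      rw [c1] at h1
      have h4 : upStarFreeMoment p s T (A.erase v \ N) ≤
          K * (Real.exp (μ * (#A - 1)) * Real.exp (-(μ * d))) := by
        refine h2.trans (mul_le_mul_of_nonneg_left ?_ hK)
        rw [← Real.exp_add, Real.exp_le_exp]
        nlinarith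
      have h5 : 0 ≤ p * Real.exp (s * T) := by positivity
      calc upStarFreeMoment p s T A
          ≤ K * Real.exp (μ * (#A - 1)) + p * Real.exp (s * T) *
            (K * (Real.exp (μ * (#A - 1)) * Real.exp (-(μ * d)))) :=
            h3.trans (add_le_add h1 (mul_le_mul_of_nonneg_left h4 h5))
        _ = K * Real.exp (μ * (#A - 1)) *
            (1 + p * Real.exp (s * T) * Real.exp (-(μ * d))) := by ring
        _ ≤ K * Real.exp (μ * (#A - 1)) * Real.exp μ := by
            refine mul_le_mul_of_nonneg_left ?_ (by positivity)
            have := Real.add_one_le_exp μ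
            linarith
        _ = K * Real.exp (μ * #A) := by
            rw [mul_assoc, ← Real.exp_add]
            ring_nf

end UpStarFreeMoment

section LubellDegree

/-- The expected number of members of `F` on a uniformly random maximal chain from `S` to
`{0, …, n - 1}`. -/
noncomputable def lubellAbove (n : ℕ) (F : Finset (Finset ℕ)) (S : Finset ℕ) : ℝ :=
  ∑ a ∈ F with S ⊆ a, ((n - #S).choose (#a - #S) : ℝ)⁻¹

variable {n : ℕ} {F : Finset (Finset ℕ)} {S : Finset ℕ}

lemma inv_choose_eq_sum_inv_choose_insert {a : Finset ℕ} (ha : a ⊆ range n) (hS : S ⊂ a) :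
    ((n - #S).choose (#a - #S) : ℝ)⁻¹ = (n - #S : ℝ)⁻¹ *
      ∑ i ∈ range n \ S with insert i S ⊆ a,
        ((n - #(insert i S)).choose (#a - #(insert i S)) : ℝ)⁻¹ := by
  have h1 : {i ∈ range n \ S | insert i S ⊆ a} = a \ S := by
    ext i
    simp only [mem_filter, mem_sdiff, insert_subset_iff]
    exact ⟨fun h => ⟨h.2.1, h.1.2⟩, fun h => ⟨⟨ha h.1, h.2⟩, h.1, hS.1⟩⟩
  have hc : #S < #a := card_lt_card hS
  have hn : #a ≤ n := by simpa using card_le_card ha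
  rw [h1]
  have h2 : ∀ i ∈ a \ S, ((n - #(insert i S)).choose (#a - #(insert i S)) : ℝ)⁻¹ =
      ((n - #S - 1).choose (#a - #S - 1) : ℝ)⁻¹ := fun i hi => by
    rw [card_insert_of_notMem (mem_sdiff.1 hi).2]
    rfl
  rw [sum_congr rfl h2, sum_const, card_sdiff_of_subset hS.1, nsmul_eq_mul]
  obtain ⟨m, hm⟩ : ∃ m, n - #S = m + 1 := ⟨n - #S - 1, by omega⟩
  obtain ⟨k, hk⟩ : ∃ k, #a - #S = k + 1 := ⟨#a - #S - 1, by omega⟩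
  have hm' : (n - #S : ℝ) = m + 1 := by
    rw [← Nat.cast_sub (by omega), hm]; push_cast; ring
  rw [hm', hm, hk, Nat.add_sub_cancel, Nat.add_sub_cancel]
  have h3 : ((m + 1 : ℕ) : ℝ) * (m.choose k) = ((m + 1).choose (k + 1)) * ((k + 1 : ℕ) : ℝ) := by
    exact_mod_cast Nat.add_one_mul_choose_eq m k
  have h4 : (0 : ℝ) < m.choose k := by exact_mod_cast Nat.choose_pos (by omega)
  have h5 : (0 : ℝ) < (m + 1).choose (k + 1) := by exact_mod_cast Nat.choose_pos (by omega)
  push_cast at *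
  field_simp
  linarith

lemma sum_ssubset_inv_choose_eq (hF : ∀ a ∈ F, a ⊆ range n) :
    ∑ a ∈ F with S ⊂ a, ((n - #S).choose (#a - #S) : ℝ)⁻¹ =
      (n - #S : ℝ)⁻¹ * ∑ i ∈ range n \ S, lubellAbove n F (insert i S) := by
  have h1 : ∀ a ∈ {a ∈ F | S ⊂ a}, ((n - #S).choose (#a - #S) : ℝ)⁻¹ = (n - #S : ℝ)⁻¹ *
      ∑ i ∈ range n \ S, if insert i S ⊆ a then
        ((n - #(insert i S)).choose (#a - #(insert i S)) : ℝ)⁻¹ else 0 := fun a ha => by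
    rw [mem_filter] at ha
    rw [inv_choose_eq_sum_inv_choose_insert (hF a ha.1) ha.2, sum_filter]
  rw [sum_congr rfl h1, ← mul_sum, sum_comm]
  congr 1
  refine sum_congr rfl fun i hi => ?_
  rw [← sum_filter, lubellAbove, filter_filter]
  refine sum_congr (filter_congr fun a _ => ?_) fun _ _ => rfl
  refine ⟨fun h => h.2, fun h => ⟨?_, h⟩⟩
  exact (ssubset_insert (mem_sdiff.1 hi).2).trans_subset h

lemma lubellAbove_le {η : ℝ} (hη : 0 ≤ η) (hF : ∀ a ∈ F, a ⊆ range n)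
    (hdeg : ∀ a ∈ F, ∑ b ∈ F with a ⊂ b, ((n - #a).choose (#b - #a) : ℝ)⁻¹ ≤ η)
    (hS : S ⊆ range n) : lubellAbove n F S ≤ 1 + η := by
  induction hk : n - #S using Nat.strong_induction_on generalizing S with
  | _ k ih =>
    have hc : #S ≤ n := by simpa using card_le_card hS
    have split : lubellAbove n F S = (if S ∈ F then 1 else 0) +
        ∑ a ∈ F with S ⊂ a, ((n - #S).choose (#a - #S) : ℝ)⁻¹ := by
      have h1 : {a ∈ F | S ⊆ a} = {a ∈ F | S = a} ∪ {a ∈ F | S ⊂ a} := by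
        rw [← filter_or]
        exact filter_congr fun a _ => by rw [← le_iff_eq_or_lt]
      rw [lubellAbove, h1, sum_union, filter_eq]
      · split_ifs <;> simp
      · rw [disjoint_filter]
        rintro a _ rfl
        exact ssubset_irrefl _
    by_cases hSF : S ∈ F
    · rw [split, if_pos hSF]
      linarith [hdeg S hSF]
    · rw [split, if_neg hSF, zero_add, sum_ssubset_inv_choose_eq hF]
      rcases hc.eq_or_lt with h | h
      · simp [h]
        linarith
      · have hpos : (0 : ℝ) < n - #S := by
          rw [sub_pos]; exact_mod_cast h
        have h2 : ∑ i ∈ range n \ S, lubellAbove n F (insert i S) ≤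
            ∑ i ∈ range n \ S, (1 + η) := by
          refine sum_le_sum fun i hi => ?_
          rw [mem_sdiff] at hi
          refine ih _ ?_ (insert_subset hi.1 hS) rfl
          rw [card_insert_of_notMem hi.2]
          omega
        rw [sum_const, card_sdiff_of_subset hS, card_range, nsmul_eq_mul, Nat.cast_sub hc] at h2
        rw [inv_mul_le_iff₀ hpos]
        exact h2

lemma card_le_of_sum_inv_choose_le {η : ℝ} (hη : 0 ≤ η) (hF : ∀ a ∈ F, a ⊆ range n)
    (hdeg : ∀ a ∈ F, ∑ b ∈ F with a ⊂ b, ((n - #a).choose (#b - #a) : ℝ)⁻¹ ≤ η) :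
    (#F : ℝ) ≤ (1 + η) * n.choose (n / 2) := by
  have h1 := lubellAbove_le hη hF hdeg (empty_subset _)
  have hM : (0 : ℝ) < n.choose (n / 2) := by
    exact_mod_cast Nat.choose_pos (Nat.div_le_self n 2)
  rw [← div_le_iff₀ hM]
  refine le_trans ?_ h1
  have : ∀ a ∈ F, ((n.choose (n / 2) : ℝ))⁻¹ ≤ (n.choose #a : ℝ)⁻¹ := fun a ha => by
    have hc : #a ≤ n := by simpa using card_le_card (hF a ha)
    have h0 : (0 : ℝ) < n.choose #a := by exact_mod_cast Nat.choose_pos hc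
    exact inv_anti₀ h0 (by exact_mod_cast Nat.choose_le_middle _ _)
  simpa [lubellAbove, div_eq_mul_inv] using sum_le_sum this

lemma choose_add_le_choose {m j k : ℕ} (hkj : k ≤ j) (hjm : j ≤ m) :
    (m - j + k).choose k ≤ m.choose j := by
  obtain ⟨c, rfl⟩ := Nat.exists_eq_add_of_le hkj
  obtain ⟨e, rfl⟩ := Nat.exists_eq_add_of_le hjm
  rw [Nat.add_sub_cancel_left, ← Nat.choose_symm_add, Nat.add_comm k c, Nat.add_comm (c + k) e]
  rw [← Nat.choose_symm_add (a := e) (b := c + k)]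
  exact Nat.choose_le_choose _ (by omega)

/-- A family of sets that are not too large, whose comparable pairs differ by at least `k`
elements and whose up-degrees are at most `η * (n / 3) ^ k / k !`, is not much larger than the
largest antichain. -/
lemma card_le_of_card_ssupset_le {k : ℕ} {η d : ℝ} (hη : 0 ≤ η)
    (hF : ∀ a ∈ F, a ⊆ range n ∧ 3 * #a ≤ 2 * n)
    (hk : ∀ a ∈ F, ∀ b ∈ F, a ⊂ b → #a + k ≤ #b)
    (hdeg : ∀ a ∈ F, (#{b ∈ F | a ⊂ b} : ℝ) ≤ d)
    (hd : d * k.factorial ≤ η * (n / 3 : ℝ) ^ k) :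
    (#F : ℝ) ≤ (1 + η) * n.choose (n / 2) := by
  rcases n.eq_zero_or_pos with rfl | hn
  · have : F ⊆ {∅} := fun a ha => by simpa using (hF a ha).1
    have := card_le_card this
    have h : (#F : ℝ) ≤ 1 := by exact_mod_cast this
    simp
    linarith
  refine card_le_of_sum_inv_choose_le hη (fun a ha => (hF a ha).1) fun a ha => ?_
  have hpos : (0 : ℝ) < (n / 3 : ℝ) ^ k := by positivity
  have hkf : (0 : ℝ) < k.factorial := by exact_mod_cast k.factorial_pos
  have h1 : ∀ b ∈ {b ∈ F | a ⊂ b}, ((n - #a).choose (#b - #a) : ℝ)⁻¹ ≤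
      k.factorial / (n / 3 : ℝ) ^ k := fun b hb => by
    rw [mem_filter] at hb
    have h2 := hk a ha b hb.1 hb.2
    have h3 := (hF b hb.1).2
    have h4 : (n - #a - (#b - #a) + k).choose k ≤ (n - #a).choose (#b - #a) :=
      choose_add_le_choose (by omega) (by omega)
    have h5 : n - #a - (#b - #a) = n - #b := by omega
    rw [h5] at h4
    have h6 : (n - #b) ^ k ≤ (n - #b + k).choose k * k.factorial := by
      rw [mul_comm, ← Nat.descFactorial_eq_factorial_mul_choose]
      refine le_trans (Nat.pow_le_pow_left ?_ k) (Nat.pow_sub_le_descFactorial _ _)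
      omega
    have h7 : (n / 3 : ℝ) ≤ (n - #b : ℕ) := by
      rw [div_le_iff₀ (by norm_num)]
      have : n ≤ (n - #b) * 3 := by omega
      exact_mod_cast this
    rw [inv_le_comm₀ (by exact_mod_cast Nat.choose_pos (by omega)) (by positivity), inv_div,
      div_le_iff₀ hkf]
    calc (n / 3 : ℝ) ^ k ≤ ((n - #b : ℕ) : ℝ) ^ k := by gcongr
      _ ≤ ((n - #b + k).choose k * k.factorial : ℕ) := by exact_mod_cast h6
      _ ≤ _ := by
        push_cast
        have : ((n - #b + k).choose k : ℝ) ≤ (n - #a).choose (#b - #a) := by exact_mod_cast h4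
        gcongr
  refine (sum_le_card_nsmul _ _ _ h1).trans ?_
  rw [nsmul_eq_mul, ← mul_div_assoc, div_le_iff₀ hpos]
  exact (mul_le_mul_of_nonneg_right (hdeg a ha) hkf.le).trans hd

lemma exists_card_ssupset_ge_of_large {ε : ℝ} (hε : 0 ≤ ε)
    (hF : ∀ a ∈ F, a ⊆ range n ∧ 3 * #a ≤ 2 * n)
    (hcard : (1 + ε) * n.choose (n / 2) < #F) :
    ∃ v ∈ F, ε * n / 3 ≤ #{b ∈ F | v ⊂ b} := by
  by_contra! h
  refine hcard.not_ge (card_le_of_card_ssupset_le (k := 1) (d := ε * n / 3) hε hF ?_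
    (fun a ha => (h a ha).le) ?_)
  · exact fun a _ b _ hab => card_lt_card hab
  · simp
    linarith

lemma exists_card_ssupset_ge_of_very_large
    (hF : ∀ a ∈ F, a ⊆ range n ∧ 3 * #a ≤ 2 * n)
    (hcard : (6 : ℝ) * n.choose (n / 2) < #F) :
    ∃ v ∈ F, (n : ℝ) ^ 3 / 162 ≤ #{b ∈ F | v ⊂ b} := by
  by_contra! h
  have h1 : ∀ r ∈ range 3, (#{a ∈ F | #a % 3 = r} : ℝ) ≤ (1 + 1) * n.choose (n / 2) := by
    intro r _
    refine card_le_of_card_ssupset_le (k := 3) (d := (n : ℝ) ^ 3 / 162) zero_le_one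
      (fun a ha => hF a (mem_filter.1 ha).1) ?_ (fun a ha => ?_) ?_
    · intro a ha b hb hab
      have := card_lt_card hab
      simp only [mem_filter] at ha hb
      omega
    · refine le_trans ?_ (h a (mem_filter.1 ha).1).le
      exact_mod_cast card_le_card (filter_subset_filter _ (filter_subset _ _))
    · simp [Nat.factorial]
      apply le_of_eq
      ring
  have h2 : #F = ∑ r ∈ range 3, #{a ∈ F | #a % 3 = r} :=
    card_eq_sum_card_fiberwise fun a _ => by simpa using Nat.mod_lt _ (by norm_num)
  have h3 := sum_le_sum h1
  rw [sum_const, card_range, nsmul_eq_mul] at h3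
  rw [h2] at hcard
  push_cast at *
  linarith

end LubellDegree

/-- The members of `F` from which `T`-fold branching upward in `F` can be continued for `k`
steps. -/
def branchingLevel (T : ℕ) (F : Finset (Finset ℕ)) : ℕ → Finset (Finset ℕ)
  | 0 => F
  | k + 1 => {a ∈ F | T ≤ #{b ∈ branchingLevel T F k | a ⊂ b}}

section BranchingLevel

variable {T : ℕ} {F : Finset (Finset ℕ)}

lemma branchingLevel_subset (k : ℕ) : branchingLevel T F k ⊆ F := by
  cases k with
  | zero => exact Subset.refl F
  | succ k => exact filter_subset _ _

lemma branchingLevel_succ_subset (k : ℕ) :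
    branchingLevel T F (k + 1) ⊆ branchingLevel T F k := by
  induction k with
  | zero => exact filter_subset _ _
  | succ k ih =>
    intro a ha
    rw [branchingLevel, mem_filter] at ha ⊢
    exact ⟨ha.1, ha.2.trans (card_le_card (filter_subset_filter _ ih))⟩

lemma upStarFree_branchingLevel_sdiff (k : ℕ) :
    UpStarFree T (branchingLevel T F k \ branchingLevel T F (k + 1)) := by
  intro a ha
  rw [mem_sdiff] at ha
  by_contra! h
  refine ha.2 ?_
  simp only [branchingLevel, mem_filter]
  exact ⟨branchingLevel_subset k ha.1,
    h.trans (card_le_card (filter_subset_filter _ sdiff_subset))⟩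

lemma card_le_mul_maxUpStarFreeSub {G : Finset (Finset ℕ)} (hFG : F ⊆ G) (k : ℕ) :
    #F ≤ k * maxUpStarFreeSub T G + #(branchingLevel T F k) := by
  induction k with
  | zero => simp [branchingLevel]
  | succ k ih =>
    have h1 := card_le_maxUpStarFreeSub
      (sdiff_subset.trans ((branchingLevel_subset k).trans hFG))
      (upStarFree_branchingLevel_sdiff (T := T) (F := F) k)
    have h2 := card_sdiff_add_card_eq_card (branchingLevel_succ_subset (T := T) (F := F) k)
    rw [Nat.succ_mul]
    omega

lemma exists_tree_embedding {α : Type*} [DecidableEq α] {m : ℕ} {r : Finset ℕ}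
    (hr : r ∈ branchingLevel T F m) (S : Finset (List α)) (hS : ∀ l ∈ S, l.dropLast ∈ S)
    (hlen : ∀ l ∈ S, l.length ≤ m) (hT : #S ≤ T) :
    ∃ φ : List α → Finset ℕ, Set.InjOn φ S ∧
      (∀ l ∈ S, φ l ∈ branchingLevel T F (m - l.length)) ∧
      ∀ a ∈ S, ∀ b ∈ S, a <+: b → φ a ⊆ φ b := by
  induction hk : #S generalizing S with
  | zero =>
    rw [card_eq_zero] at hk
    subst hk
    exact ⟨fun _ => ∅, by simp⟩
  | succ k ih =>
    have hne : S.Nonempty := card_pos.1 (by omega)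
    obtain ⟨l, hl, hmax⟩ := exists_max_image S List.length hne
    rcases eq_or_ne l [] with rfl | hl0
    · have hSnil : ∀ a ∈ S, a = [] := fun a ha => by simpa using hmax a ha
      refine ⟨fun _ => r, fun a ha b hb _ => (hSnil a ha).trans (hSnil b hb).symm,
        fun a ha => ?_, fun _ _ _ _ _ => Subset.refl r⟩
      rw [hSnil a ha]
      exact hr
    have hpos : 0 < l.length := List.length_pos_iff.2 hl0
    have hlm := hlen l hl
    have hdrop : l.dropLast ≠ l := fun h => by
      have := congrArg List.length h
      rw [List.length_dropLast] at this
      omega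
    obtain ⟨φ, hinj, hφ, hmono⟩ := ih (S.erase l)
      (fun a ha => by
        rw [mem_erase] at ha ⊢
        refine ⟨fun h => ?_, hS a ha.2⟩
        have h1 := hmax a ha.2
        have h2 := congrArg List.length h
        rw [List.length_dropLast] at h2
        omega)
      (fun a ha => hlen a (mem_of_mem_erase ha))
      ((card_le_card (erase_subset _ _)).trans hT)
      (by rw [card_erase_of_mem hl]; omega)
    have hparent : l.dropLast ∈ S.erase l := mem_erase.2 ⟨hdrop, hS l hl⟩
    have hup := hφ _ hparent
    have hidx : m - l.dropLast.length = m - l.length + 1 := by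
      rw [List.length_dropLast]; omega
    rw [hidx] at hup
    simp only [branchingLevel, mem_filter] at hup
    have hcard : #((S.erase l).image φ) <
        #{b ∈ branchingLevel T F (m - l.length) | φ l.dropLast ⊂ b} := by
      refine card_image_le.trans_lt (lt_of_lt_of_le ?_ (hT.trans hup.2))
      exact card_lt_card (erase_ssubset hl)
    obtain ⟨c, hc, hcnot⟩ := exists_mem_notMem_of_card_lt_card hcard
    rw [mem_filter] at hc
    have hval : ∀ a ∈ S, a ≠ l → Function.update φ l c a = φ a :=
      fun a _ h => Function.update_of_ne h _ _
    have hcφ : ∀ a ∈ S, a ≠ l → φ a ≠ c := fun a ha h hac =>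
      hcnot (mem_image.2 ⟨a, mem_erase.2 ⟨h, ha⟩, hac⟩)
    refine ⟨Function.update φ l c, fun a ha b hb hab => ?_, fun a ha => ?_,
      fun a ha b hb hab => ?_⟩
    · rcases eq_or_ne a l with rfl | hal <;> rcases eq_or_ne b a with rfl | hba
      · rfl
      · rw [Function.update_self, hval b hb hba] at hab
        exact absurd hab.symm (hcφ b hb hba)
      · rfl
      · rcases eq_or_ne b l with rfl | hbl
        · rw [Function.update_self, hval a ha hal] at hab
          exact absurd hab (hcφ a ha hal)
        · rw [hval a ha hal, hval b hb hbl] at hab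
          exact hinj (mem_erase.2 ⟨hal, ha⟩) (mem_erase.2 ⟨hbl, hb⟩) hab
    · rcases eq_or_ne a l with rfl | hal
      · rw [Function.update_self]
        exact hc.1
      · rw [hval a ha hal]
        exact hφ a (mem_erase.2 ⟨hal, ha⟩)
    · rcases eq_or_ne b l with rfl | hbl
      · rcases eq_or_ne a b with rfl | hab'
        · exact Subset.refl _
        · rw [Function.update_self, hval a ha hab']
          refine (hmono a (mem_erase.2 ⟨hab', ha⟩) _ hparent ?_).trans hc.2.1
          have hlt : a.length < b.length :=
            lt_of_le_of_ne hab.length_le fun h => hab' (hab.eq_of_length h)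
          refine List.prefix_of_prefix_length_le hab (List.dropLast_prefix b) ?_
          rw [List.length_dropLast]
          omega
      · rcases eq_or_ne a l with rfl | hal
        · exact absurd (hab.eq_of_length (le_antisymm hab.length_le (hmax b hb))).symm hbl
        · rw [hval a ha hal, hval b hb hbl]
          exact hmono a (mem_erase.2 ⟨hal, ha⟩) b (mem_erase.2 ⟨hbl, hb⟩) hab

/-- A `P_{t,h}`-free family is a union of `h - 1` families with bounded up-degrees. -/
lemma exists_forall_maxPthFreeSub_le (t h : ℕ) :
    ∃ T : ℕ, ∀ G, maxPthFreeSub t h G ≤ (h - 1) * maxUpStarFreeSub T G := by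
  classical
  set S := (List.finite_length_le (Fin t) (h - 1)).toFinset with hS
  have hmem : ∀ l, l ∈ S ↔ l.length ≤ h - 1 := fun l => by simp [hS]
  refine ⟨#S, fun G => Finset.sup_le fun F hF => ?_⟩
  simp only [mem_filter, mem_powerset] at hF
  have h1 := card_le_mul_maxUpStarFreeSub (T := #S) hF.1 (h - 1)
  rcases (branchingLevel #S F (h - 1)).eq_empty_or_nonempty with h2 | ⟨r, hr⟩
  · simpa [h2] using h1
  · obtain ⟨φ, hinj, hφ, hmono⟩ := exists_tree_embedding hr S
      (fun l hl => by
        rw [hmem] at hl ⊢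
        rw [List.length_dropLast]
        omega)
      (fun l hl => (hmem l).1 hl) le_rfl
    refine absurd ⟨fun l => φ l.1, fun a b hab => ?_, fun a => ?_, fun a b hab => ?_⟩ hF.2
    · exact Subtype.ext (hinj ((hmem _).2 a.2) ((hmem _).2 b.2) hab)
    · exact branchingLevel_subset _ (hφ _ ((hmem _).2 a.2))
    · exact hmono _ ((hmem _).2 a.2) _ ((hmem _).2 b.2) hab

end BranchingLevel

lemma pthFree_of_card_range {t h m : ℕ} (ht : 1 ≤ t) {F : Finset (Finset ℕ)}
    (hF : ∀ a ∈ F, m ≤ #a ∧ #a < m + (h - 1)) : PthFree t h F := by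
  rintro ⟨φ, hinj, hφ, hmono⟩
  set x : Fin t := ⟨0, ht⟩
  let v : ∀ k ≤ h - 1, PthVert t h := fun k hk => ⟨List.replicate k x, by simpa using hk⟩
  have key : ∀ k, ∀ hk : k ≤ h - 1, m + k ≤ #(φ (v k hk)) := by
    intro k
    induction k with
    | zero => exact fun hk => (hF _ (hφ _)).1
    | succ k ih =>
      intro hk
      have h1 := ih (by omega)
      have h2 : φ (v k (by omega)) ⊂ φ (v (k + 1) hk) := by
        refine (hmono _ _ ?_).ssubset_of_ne fun heq => ?_
        · exact ⟨[x], by simp [v, List.replicate_succ']⟩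
        · have := congrArg (fun l : PthVert t h => l.1.length) (hinj heq)
          simp [v] at this
      have := card_lt_card h2
      omega
  have h1 := key (h - 1) le_rfl
  have h2 := (hF _ (hφ (v (h - 1) le_rfl))).2
  omega

lemma card_inter_le_maxPthFreeSub {t h m : ℕ} (ht : 1 ≤ t)
    {G L : Finset (Finset ℕ)} (hL : ∀ a ∈ L, m ≤ #a ∧ #a < m + (h - 1)) :
    #(G ∩ L) ≤ maxPthFreeSub t h G := by
  classical
  refine Finset.le_sup (f := Finset.card) ?_
  simp only [mem_filter, mem_powerset]
  exact ⟨inter_subset_left,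
    pthFree_of_card_range ht fun a ha => hL a (mem_inter.1 ha).2⟩

section Asymptotics

open Filter

lemma two_pow_le_mul_choose_middle (n : ℕ) :
    (2 : ℝ) ^ n ≤ (n + 1) * n.choose (n / 2) := by
  have h : ∑ k ∈ range (n + 1), n.choose k ≤ (n + 1) * n.choose (n / 2) := by
    simpa using sum_le_card_nsmul (range (n + 1)) _ _ fun k _ => Nat.choose_le_middle k n
  rw [Nat.sum_range_choose] at h
  exact_mod_cast h

lemma eventually_card_large_sets_le {δ : ℝ} (hδ : 0 < δ) :
    ∀ᶠ n : ℕ in atTop, (#{a ∈ (range n).powerset | ¬3 * #a ≤ 2 * n} : ℝ) ≤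
      δ * n.choose (n / 2) := by
  have h1 : Tendsto (fun n : ℕ => (n : ℝ) * (30 / 31 : ℝ) ^ n + (30 / 31 : ℝ) ^ n) atTop
      (nhds (0 + 0)) :=
    (tendsto_self_mul_const_pow_of_lt_one (by norm_num) (by norm_num)).add
      (tendsto_pow_atTop_nhds_zero_of_lt_one (by norm_num) (by norm_num))
  rw [add_zero] at h1
  filter_upwards [h1.eventually_le_const hδ] with n hn
  have h2 : ∀ a ∈ {a ∈ (range n).powerset | ¬3 * #a ≤ 2 * n},
      (31 / 20 : ℝ) ^ n ≤ 2 ^ #a := fun a ha => by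
    rw [mem_filter] at ha
    refine le_of_pow_le_pow_left₀ (n := 3) (by norm_num) (by positivity) ?_
    calc ((31 / 20 : ℝ) ^ n) ^ 3 = ((31 / 20 : ℝ) ^ 3) ^ n := pow_right_comm _ _ _
      _ ≤ 4 ^ n := by gcongr; norm_num
      _ = 2 ^ (2 * n) := by rw [pow_mul]; norm_num
      _ ≤ 2 ^ (#a * 3) := pow_le_pow_right₀ (by norm_num) (by omega)
      _ = _ := pow_mul _ _ _
  have h3 := card_nsmul_le_sum _ _ _ h2
  have h4 : ∑ a ∈ {a ∈ (range n).powerset | ¬3 * #a ≤ 2 * n}, (2 : ℝ) ^ #a ≤ 3 ^ n := by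
    refine (sum_le_sum_of_subset_of_nonneg (filter_subset _ _)
      fun _ _ _ => by positivity).trans_eq ?_
    have := Finset.sum_pow_mul_eq_add_pow (2 : ℝ) 1 (range n)
    simp only [one_pow, mul_one, card_range] at this
    rw [this]
    norm_num
  rw [nsmul_eq_mul] at h3
  have h5 : (#{a ∈ (range n).powerset | ¬3 * #a ≤ 2 * n} : ℝ) ≤ (30 / 31) ^ n * 2 ^ n := by
    refine le_of_mul_le_mul_right (h3.trans (h4.trans_eq ?_))
      (show (0 : ℝ) < (31 / 20) ^ n by positivity)
    rw [← mul_pow, ← mul_pow]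
    norm_num
  refine h5.trans ?_
  calc (30 / 31 : ℝ) ^ n * 2 ^ n ≤ (30 / 31) ^ n * ((n + 1) * n.choose (n / 2)) := by
        gcongr; exact two_pow_le_mul_choose_middle n
    _ = ((n : ℝ) * (30 / 31 : ℝ) ^ n + (30 / 31 : ℝ) ^ n) * n.choose (n / 2) := by ring
    _ ≤ _ := by gcongr

lemma eventually_mul_choose_middle_le (i : ℕ) {δ : ℝ} (hδ : 0 < δ) :
    ∀ᶠ n : ℕ in atTop, (1 - δ) * n.choose (n / 2) ≤ n.choose (n / 2 + i) := by
  induction i generalizing δ with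
  | zero =>
    filter_upwards with n
    have : (0 : ℝ) ≤ n.choose (n / 2) := by positivity
    simp only [add_zero]
    nlinarith
  | succ i ih =>
    rcases le_or_gt 1 δ with h1 | h1
    · filter_upwards with n
      refine (mul_nonpos_of_nonpos_of_nonneg (by linarith) (by positivity)).trans (by positivity)
    filter_upwards [ih (half_pos hδ),
      tendsto_natCast_atTop_atTop.eventually_ge_atTop ((2 * i + 1) * 4 / δ),
      eventually_ge_atTop (2 * i + 2)] with n hn hbig hn2
    rw [div_le_iff₀ hδ] at hbig
    have h2 : ((n.choose (n / 2 + i + 1) : ℕ) : ℝ) * (n / 2 + i + 1 : ℕ) =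
        n.choose (n / 2 + i) * (n - (n / 2 + i) : ℕ) := by
      exact_mod_cast Nat.choose_succ_right_eq n (n / 2 + i)
    have h3 : (1 - δ / 2) * ((n / 2 + i + 1 : ℕ) : ℝ) ≤ (n - (n / 2 + i) : ℕ) := by
      have e1 : n - (n / 2 + i) + 2 * i + 1 ≥ n / 2 + i + 1 := by omega
      have e2 : (n : ℝ) ≤ 2 * ((n / 2 + i + 1 : ℕ) : ℝ) := by
        exact_mod_cast (show n ≤ 2 * (n / 2 + i + 1) by omega)
      have e3 : ((n / 2 + i + 1 : ℕ) : ℝ) ≤ ((n - (n / 2 + i) : ℕ) : ℝ) + 2 * i + 1 := by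
        exact_mod_cast e1
      nlinarith
    have hpos : (0 : ℝ) < ((n / 2 + i + 1 : ℕ) : ℝ) := by positivity
    refine le_of_mul_le_mul_right ?_ hpos
    rw [← add_assoc, h2]
    have hM : (0 : ℝ) ≤ n.choose (n / 2) := by positivity
    calc (1 - δ) * (n.choose (n / 2) : ℝ) * ((n / 2 + i + 1 : ℕ) : ℝ)
        ≤ ((1 - δ / 2) * (n.choose (n / 2) : ℝ)) *
          ((1 - δ / 2) * ((n / 2 + i + 1 : ℕ) : ℝ)) := by
          have : 0 ≤ δ / 2 * (δ / 2) * ((n.choose (n / 2) : ℝ) * ((n / 2 + i + 1 : ℕ) : ℝ)) := by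
            positivity
          linarith
      _ ≤ _ := by
          refine mul_le_mul hn h3 ?_ (by positivity)
          exact mul_nonneg (by linarith) hpos.le

lemma eventually_mul_choose_middle_le_card_layers (q : ℕ) (hq : 1 ≤ q) {δ : ℝ} (hδ : 0 < δ) :
    ∀ᶠ n : ℕ in atTop, (q - δ) * n.choose (n / 2) ≤
      #{a ∈ (range n).powerset | n / 2 ≤ #a ∧ #a < n / 2 + q} := by
  have hq' : (0 : ℝ) < q := by exact_mod_cast hq
  have h1 : ∀ᶠ n : ℕ in atTop, ∀ i ∈ range q,
      (1 - δ / q) * (n.choose (n / 2) : ℝ) ≤ n.choose (n / 2 + i) :=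
    (eventually_all_finset _).2 fun i _ => eventually_mul_choose_middle_le i (by positivity)
  filter_upwards [h1] with n hn
  have h2 : #{a ∈ (range n).powerset | n / 2 ≤ #a ∧ #a < n / 2 + q} =
      ∑ i ∈ range q, n.choose (n / 2 + i) := by
    rw [card_eq_sum_card_fiberwise (f := fun a => #a - n / 2) (t := range q)]
    · refine sum_congr rfl fun i hi => ?_
      rw [mem_range] at hi
      conv_rhs => rw [← card_range n]
      rw [← card_powersetCard, card_range]
      congr 1
      ext a
      simp only [mem_filter, mem_powerset, mem_powersetCard]
      constructor
      · rintro ⟨⟨h, h₁, -⟩, h'⟩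
        exact ⟨h, by omega⟩
      · rintro ⟨h, h'⟩
        exact ⟨⟨h, by omega⟩, by omega⟩
    · intro a ha
      simp only [coe_filter, mem_powerset, Set.mem_ofPred_eq] at ha
      simp only [coe_range, Set.mem_Iio]
      omega
  have h3 := sum_le_sum hn
  rw [sum_const, card_range, nsmul_eq_mul] at h3
  rw [h2]
  push_cast
  refine le_trans (le_of_eq ?_) h3
  field_simp

lemma tendsto_mul_choose_middle {C : ℝ} (hC : 0 < C) {p : ℕ → ℝ}
    (hp : ∀ᶠ n : ℕ in atTop, C / n < p n) :
    Tendsto (fun n => p n * (n.choose (n / 2) : ℝ)) atTop atTop := by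
  have h1 : Tendsto (fun n : ℕ => C / 2 * ((n : ℝ) - 1)) atTop atTop :=
    (tendsto_atTop_add_const_right _ (-1) tendsto_natCast_atTop_atTop).const_mul_atTop
      (half_pos hC)
  refine tendsto_atTop_mono' _ ?_ h1
  filter_upwards [hp, eventually_gt_atTop 0] with n hn hn0
  have hn0' : (0 : ℝ) < n := by exact_mod_cast hn0
  have h2 : (n : ℝ) * (n - 1) / 2 ≤ n.choose (n / 2) := by
    rw [← Nat.cast_choose_two]
    exact_mod_cast Nat.choose_le_middle 2 n
  calc C / 2 * ((n : ℝ) - 1) = C / n * (n * (n - 1) / 2) := by field_simp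
    _ ≤ C / n * n.choose (n / 2) := by gcongr
    _ ≤ _ := by gcongr

end Asymptotics

section UpperTail

variable {n T : ℕ} {p s ε γ : ℝ}

lemma exp_sub_one_le (hs0 : 0 ≤ s) (hs1 : s ≤ 1) : Real.exp s - 1 ≤ s * (1 + s) := by
  have := (abs_le.1 (Real.abs_exp_sub_one_sub_id_le (x := s) (by rwa [abs_of_nonneg hs0]))).2
  linarith

lemma upStarFreeMoment_powerset_le (hp0 : 0 ≤ p) (hp1 : p ≤ 1) (hε0 : 0 < ε) (hε1 : ε ≤ 1)
    (hs : s = ε / 16) (hγ : γ = s * ε / 16)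
    (hout : (#{a ∈ (range n).powerset | ¬3 * #a ≤ 2 * n} : ℝ) ≤ s * n.choose (n / 2))
    (hlarge : p * Real.exp (s * T) * Real.exp (-(γ * p / 6 * (ε / 4 * n / 3))) ≤ γ * p / 6)
    (hvlarge : p * Real.exp (s * T) * Real.exp (-(γ * p / (n + 1) * (n ^ 3 / 162))) ≤
      γ * p / (n + 1)) :
    upStarFreeMoment p s T (range n).powerset ≤
      Real.exp (s * (1 + 3 * ε / 4) * (p * n.choose (n / 2))) := by
  set M : ℝ := (n.choose (n / 2) : ℝ) with hM
  have hM0 : 0 ≤ M := by positivity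
  have hs0 : 0 < s := by rw [hs]; positivity
  have hs1 : s ≤ 1 := by rw [hs]; linarith
  have hγ0 : 0 < γ := by rw [hγ]; positivity
  have hexp := exp_sub_one_le hs0.le hs1
  have hexp0 : 0 ≤ Real.exp s - 1 := by linarith [Real.add_one_le_exp s]
  set V := {a ∈ (range n).powerset | 3 * #a ≤ 2 * n} with hV
  have hVmem : ∀ A ⊆ V, ∀ a ∈ A, a ⊆ range n ∧ 3 * #a ≤ 2 * n := fun A hA a ha => by
    simpa [hV] using hA ha
  set K := Real.exp (p * (Real.exp s - 1) * ((1 + ε / 4) * M)) with hK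
  have h1 : ∀ A ⊆ V, (#A : ℝ) ≤ (1 + ε / 4) * M → upStarFreeMoment p s T A ≤ K :=
    fun A _ hcard => (upStarFreeMoment_le_exp_card hp0 hp1 hs0.le).trans
      (Real.exp_le_exp.2 (mul_le_mul_of_nonneg_left hcard (by positivity)))
  have h2 : ∀ A ⊆ V, (#A : ℝ) ≤ 6 * M →
      upStarFreeMoment p s T A ≤ K * Real.exp (γ * p / 6 * (6 * M)) := by
    intro A hA hcard
    refine (upStarFreeMoment_le_of_exists_large_degree hp0 hp1 hs0.le (Real.exp_pos _).le
      (by positivity) h1 (fun A hA h => ?_) hlarge hA).trans ?_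
    · exact exists_card_ssupset_ge_of_large (by positivity) (hVmem A hA) h
    · gcongr
  have h3 : upStarFreeMoment p s T V ≤
      K * Real.exp (γ * p / 6 * (6 * M)) * Real.exp (γ * p / (n + 1) * #V) :=
    upStarFreeMoment_le_of_exists_large_degree hp0 hp1 hs0.le (by positivity)
      (by positivity) h2
      (fun A hA h => exists_card_ssupset_ge_of_very_large (hVmem A hA) h) hvlarge Subset.rfl
  have h4 := upStarFreeMoment_union_le (T := T) hp0 hp1 hs0.le
    (disjoint_filter_filter_not (range n).powerset (range n).powerset fun a => 3 * #a ≤ 2 * n)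
  rw [filter_union_filter_not_eq, ← hV] at h4
  refine h4.trans ((mul_le_mul_of_nonneg_right h3 (Real.exp_pos _).le).trans ?_)
  rw [hK, ← Real.exp_add, ← Real.exp_add, ← Real.exp_add, Real.exp_le_exp]
  have hVcard : (#V : ℝ) ≤ (n + 1) * M := by
    refine le_trans ?_ (two_pow_le_mul_choose_middle n)
    have : #V ≤ 2 ^ n := by simpa using card_filter_le (range n).powerset fun a => 3 * #a ≤ 2 * n
    exact_mod_cast this
  have hpM : 0 ≤ p * M := by positivity
  have e1 : p * (Real.exp s - 1) * ((1 + ε / 4) * M) ≤ s * (1 + s) * (1 + ε / 4) * (p * M) := by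
    have := mul_le_mul_of_nonneg_right hexp (show 0 ≤ (1 + ε / 4) * (p * M) by positivity)
    linarith
  have e2 : γ * p / (n + 1) * #V ≤ γ * (p * M) := by
    calc γ * p / (n + 1) * #V ≤ γ * p / (n + 1) * ((n + 1) * M) := by gcongr
      _ = γ * (p * M) := by field_simp
  have e3 : p * (Real.exp s - 1) * #{a ∈ (range n).powerset | ¬3 * #a ≤ 2 * n} ≤
      s * (1 + s) * s * (p * M) := by
    calc _ ≤ p * (s * (1 + s)) * (s * M) := by gcongr
      _ = _ := by ring
  have e4 : γ * p / 6 * (6 * M) = γ * (p * M) := by ring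
  have e5 : (1 + s) * (1 + ε / 4) + 2 * (ε / 16) + (1 + s) * s ≤ 1 + 3 * ε / 4 := by
    rw [hs]
    nlinarith
  have e6 := mul_le_mul_of_nonneg_left e5 (show 0 ≤ s * (p * M) by positivity)
  rw [hγ] at e2 e4 ⊢
  linarith

end UpperTail

section Main

open Filter

lemma probFam_eq_randSubsetExp (n : ℕ) (p : ℝ) (E : Finset (Finset ℕ) → Prop)
    [DecidablePred E] :
    probFam n p E = randSubsetExp p (range n).powerset fun G => if E G then 1 else 0 := by
  unfold probFam randSubsetExp
  rw [sum_filter]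
  refine sum_congr rfl fun G _ => ?_
  simp only [card_powerset, card_range, mul_ite, mul_one, mul_zero]
  split_ifs <;> rfl

lemma probFam_le_one {n : ℕ} {p : ℝ} (hp0 : 0 ≤ p) (hp1 : p ≤ 1)
    (E : Finset (Finset ℕ) → Prop) : probFam n p E ≤ 1 := by
  classical
  rw [probFam_eq_randSubsetExp]
  refine le_trans (randSubsetExp_mono hp0 hp1 fun G _ => ?_) randSubsetExp_one.le
  split_ifs <;> norm_num

/-- Exponential Markov bounds for the two tails of `maxPthFreeSub`. -/
lemma one_sub_le_probFam {n t h T : ℕ} {p s s' x y z : ℝ} (hp0 : 0 ≤ p) (hp1 : p ≤ 1)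
    (hh : 2 ≤ h) (hs : 0 ≤ s) (hs' : 0 ≤ s') (L : Finset (Finset ℕ))
    (hT : ∀ G, maxPthFreeSub t h G ≤ (h - 1) * maxUpStarFreeSub T G)
    (hL : ∀ G, #(G ∩ L) ≤ maxPthFreeSub t h G) (hx : ((h : ℝ) - 1) * x ≤ z) :
    1 - (Real.exp (-(s * x)) * upStarFreeMoment p s T (range n).powerset +
      Real.exp (s' * y) * randSubsetExp p (range n).powerset
        (fun G => Real.exp (-s' * #(G ∩ L)))) ≤
      probFam n p fun G => y ≤ (maxPthFreeSub t h G : ℝ) ∧ (maxPthFreeSub t h G : ℝ) ≤ z := by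
  classical
  rw [probFam_eq_randSubsetExp, upStarFreeMoment, ← randSubsetExp_const_mul,
    ← randSubsetExp_const_mul, sub_le_iff_le_add, ← randSubsetExp_add, ← randSubsetExp_add]
  refine randSubsetExp_one.ge.trans (randSubsetExp_mono hp0 hp1 fun G _ => ?_)
  rw [← Real.exp_add, ← Real.exp_add]
  have e1 := Real.exp_pos (-(s * x) + s * maxUpStarFreeSub T G)
  have e2 := Real.exp_pos (s' * y + -s' * #(G ∩ L))
  split_ifs with hE
  · linarith
  rw [not_and_or, not_le, not_le] at hE
  have hLG : (#(G ∩ L) : ℝ) ≤ maxPthFreeSub t h G := by exact_mod_cast hL G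
  rcases hE with hE | hE
  · have : 1 ≤ Real.exp (s' * y + -s' * #(G ∩ L)) := Real.one_le_exp (by nlinarith)
    linarith
  · have hh' : (0 : ℝ) < (h : ℝ) - 1 := by
      have : (2 : ℝ) ≤ h := by exact_mod_cast hh
      linarith
    have hTG : (maxPthFreeSub t h G : ℝ) ≤ ((h : ℝ) - 1) * maxUpStarFreeSub T G := by
      have := hT G
      rw [← Nat.cast_one, ← Nat.cast_sub (by omega)]
      exact_mod_cast this
    have hxZ : x ≤ maxUpStarFreeSub T G :=
      le_of_mul_le_mul_left (hx.trans (hE.le.trans hTG)) hh'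
    have : 1 ≤ Real.exp (-(s * x) + s * maxUpStarFreeSub T G) :=
      Real.one_le_exp (by nlinarith)
    linarith

/-- The constant `C` can be chosen so that the degree conditions of
`upStarFreeMoment_powerset_le` hold for all large `n`. -/
lemma eventually_degree_conditions {ε s γ : ℝ} (hε : 0 < ε) (hs : 0 ≤ s) (hγ : 0 < γ) (T : ℕ) :
    ∃ C : ℝ, 0 < C ∧ ∀ᶠ n : ℕ in atTop, ∀ p : ℝ, C / n < p →
      p * Real.exp (s * T) * Real.exp (-(γ * p / 6 * (ε / 4 * n / 3))) ≤ γ * p / 6 ∧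
      p * Real.exp (s * T) * Real.exp (-(γ * p / (n + 1) * (n ^ 3 / 162))) ≤
        γ * p / (n + 1) := by
  set C : ℝ := 72 * (s * T + 6 / γ) / (γ * ε) with hC
  have hC0 : 0 < C := by positivity
  refine ⟨C, hC0, ?_⟩
  set c : ℝ := γ * C / 324 with hc
  have hc0 : 0 < c := by positivity
  filter_upwards [eventually_ge_atTop 1,
    tendsto_natCast_atTop_atTop.eventually_ge_atTop (4 * Real.exp (s * T) / (γ * c ^ 2))]
    with n hn1 hnbig p hp
  have hn : (1 : ℝ) ≤ n := by exact_mod_cast hn1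
  have hn0 : (0 : ℝ) < n := by linarith
  have hp0 : 0 < p := lt_trans (by positivity) hp
  rw [div_lt_iff₀ hn0] at hp
  have reduce : ∀ x r : ℝ, Real.exp (s * T) * Real.exp (-x) ≤ r →
      p * Real.exp (s * T) * Real.exp (-x) ≤ r * p := fun x r h => by
    have := mul_le_mul_of_nonneg_left h hp0.le
    linarith
  constructor
  · rw [show γ * p / 6 = γ / 6 * p by ring]
    refine reduce _ _ ?_
    rw [← Real.exp_add]
    have h1 : s * T + 6 / γ ≤ γ / 6 * p * (ε / 4 * n / 3) := by
      have h2 : s * T + 6 / γ = γ * ε / 72 * C := by rw [hC]; field_simp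
      rw [h2]
      have := mul_le_mul_of_nonneg_left hp.le (show 0 ≤ γ * ε / 72 by positivity)
      linarith
    calc Real.exp (s * T + -(γ / 6 * p * (ε / 4 * n / 3))) ≤ Real.exp (-(6 / γ)) :=
          Real.exp_le_exp.2 (by linarith)
      _ = (Real.exp (6 / γ))⁻¹ := Real.exp_neg _
      _ ≤ (6 / γ)⁻¹ := by
          refine inv_anti₀ (by positivity) ?_
          linarith [Real.add_one_le_exp (6 / γ)]
      _ = γ / 6 := inv_div _ _
  · rw [show γ * p / (n + 1) = γ / (n + 1) * p by ring]
    refine reduce _ _ ?_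
    have h1 : c * n ≤ γ / (n + 1) * p * (n ^ 3 / 162) := by
      have h2 : γ / (n + 1) * p * (n ^ 3 / 162) = γ * (p * n) * n ^ 2 / (162 * (n + 1)) := by
        field_simp
      rw [h2, le_div_iff₀ (by positivity), hc]
      have h3 : γ * C * n ^ 2 ≤ γ * (p * n) * n ^ 2 := by gcongr
      nlinarith [mul_le_mul_of_nonneg_left hn (show 0 ≤ γ * C * n by positivity)]
    have h4 : (c * n) ^ 2 / 2 ≤ Real.exp (c * n) := by
      have := Real.quadratic_le_exp_of_nonneg (show 0 ≤ c * n by positivity)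
      have : 0 ≤ c * n := by positivity
      linarith
    rw [div_le_iff₀ (by positivity)] at hnbig
    calc Real.exp (s * T) * Real.exp (-(γ / (n + 1) * p * (n ^ 3 / 162)))
        ≤ Real.exp (s * T) * Real.exp (-(c * n)) := by gcongr
      _ = Real.exp (s * T) / Real.exp (c * n) := by rw [Real.exp_neg, div_eq_mul_inv]
      _ ≤ Real.exp (s * T) / ((c * n) ^ 2 / 2) := by gcongr
      _ ≤ γ / (n + 1) := by
          rw [div_le_div_iff₀ (by positivity) (by positivity)]
          have := Real.exp_pos (s * T)
          nlinarith [mul_le_mul_of_nonneg_left hn this.le,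
            mul_le_mul_of_nonneg_left hnbig hn0.le]

lemma randSubsetExp_exp_neg_card_inter_le {α : Type*} [DecidableEq α] {p s q δ M : ℝ}
    {A L : Finset α} (hp0 : 0 ≤ p) (hp1 : p ≤ 1) (hs0 : 0 ≤ s) (hs1 : s ≤ 1)
    (hsq : s * q ≤ δ / 4) (hδ : 0 ≤ δ) (hM : 0 ≤ M) (hLA : L ⊆ A)
    (hL : (q - δ / 2) * M ≤ #L) :
    Real.exp (s * ((q - δ) * (p * M))) *
      randSubsetExp p A (fun G => Real.exp (-s * #(G ∩ L))) ≤
      Real.exp (-(s * δ / 4 * (p * M))) := by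
  have h1 := randSubsetExp_exp_card_inter_le (A := A) hp0 hp1 (-s) L
  rw [inter_eq_right.2 hLA] at h1
  refine (mul_le_mul_of_nonneg_left h1 (Real.exp_pos _).le).trans ?_
  rw [← Real.exp_add, Real.exp_le_exp]
  have h2 : Real.exp (-s) - 1 ≤ -(s * (1 - s)) := by
    have := (abs_le.1 (Real.abs_exp_sub_one_sub_id_le (x := -s)
      (by rwa [abs_neg, abs_of_nonneg hs0]))).2
    linarith
  have h3 : p * (Real.exp (-s) - 1) * #L ≤ -(s * (1 - s)) * (p * #L) := by
    have := mul_le_mul_of_nonneg_right h2 (show 0 ≤ p * #L by positivity)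
    linarith
  have h4 := mul_le_mul_of_nonneg_left hL
    (show 0 ≤ s * (1 - s) * p from mul_nonneg (mul_nonneg hs0 (by linarith)) hp0)
  have h5 := mul_le_mul_of_nonneg_left hsq (show 0 ≤ s * (p * M) by positivity)
  have h6 : 0 ≤ s * s * δ * (p * M) := by positivity
  linarith

end Main

/-- For all `t ≥ 1`, `h ≥ 2` and `ε > 0` there is `C > 0` such that for
any sequence of probabilities with `C/n < p(n)` for all large `n`, w.h.p. the largest
`P_{t,h}`-free subfamily of `𝒫(n,p(n))` has size `(h-1±ε) p(n) C(n,⌊n/2⌋)`. -/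
theorem stmt_12 (t h : ℕ) (ht : 1 ≤ t) (hh : 2 ≤ h) (ε : ℝ) (hε : 0 < ε) :
    ∃ C : ℝ, 0 < C ∧ ∀ p : ℕ → ℝ, (∀ n, 0 ≤ p n ∧ p n ≤ 1) →
      (∃ N : ℕ, ∀ n ≥ N, C / n < p n) →
      Filter.Tendsto (fun n => probFam n (p n) (fun G =>
          ((h : ℝ) - 1 - ε) * p n * (n.choose (n / 2) : ℝ) ≤ (maxPthFreeSub t h G : ℝ) ∧
          (maxPthFreeSub t h G : ℝ) ≤ ((h : ℝ) - 1 + ε) * p n * (n.choose (n / 2) : ℝ)))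
        Filter.atTop (nhds 1) := by
  have hq : (1 : ℝ) ≤ (h : ℝ) - 1 := by
    have : (2 : ℝ) ≤ h := by exact_mod_cast hh
    linarith
  have hq0 : (0 : ℝ) < (h : ℝ) - 1 := by linarith
  obtain ⟨T, hT⟩ := exists_forall_maxPthFreeSub_le t h
  set δ : ℝ := min 1 (ε / ((h : ℝ) - 1)) with hδ
  have hδ0 : 0 < δ := by positivity
  have hδ1 : δ ≤ 1 := min_le_left _ _
  have hδε : ((h : ℝ) - 1) * δ ≤ ε := by
    rw [mul_comm, ← le_div_iff₀ hq0]
    exact min_le_right _ _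
  set s : ℝ := δ / 16 with hs
  have hs0 : 0 < s := by positivity
  set s' : ℝ := min 1 (ε / (4 * ((h : ℝ) - 1))) with hs'
  have hs'0 : 0 < s' := by positivity
  have hs'q : s' * ((h : ℝ) - 1) ≤ ε / 4 := by
    have h1 : s' ≤ ε / (4 * ((h : ℝ) - 1)) := min_le_right _ _
    rw [le_div_iff₀ (by positivity)] at h1
    linarith
  set γ : ℝ := s * δ / 16 with hγ
  have hγ0 : 0 < γ := by positivity
  obtain ⟨C, hC0, hC⟩ := eventually_degree_conditions hδ0 hs0.le hγ0 T
  refine ⟨C, hC0, fun p hp ⟨N, hN⟩ => ?_⟩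
  have hpC : ∀ᶠ n : ℕ in Filter.atTop, C / n < p n := Filter.eventually_atTop.2 ⟨N, hN⟩
  have hpM := tendsto_mul_choose_middle hC0 hpC
  have hexp : ∀ c : ℝ, 0 < c → Filter.Tendsto
      (fun n => Real.exp (-(c * (p n * (n.choose (n / 2) : ℝ))))) Filter.atTop (nhds 0) :=
    fun c hc => Real.tendsto_exp_neg_atTop_nhds_zero.comp (hpM.const_mul_atTop hc)
  have hlim := ((hexp (s * δ / 4) (by positivity)).add
    (hexp (s' * ε / 4) (by positivity))).const_sub 1
  rw [add_zero, sub_zero] at hlim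
  refine tendsto_of_tendsto_of_tendsto_of_le_of_le' hlim tendsto_const_nhds ?_
    (Filter.Eventually.of_forall fun n => probFam_le_one (hp n).1 (hp n).2 _)
  filter_upwards [hC, hpC, eventually_card_large_sets_le hs0,
    eventually_mul_choose_middle_le_card_layers (h - 1) (by omega) (half_pos hε)]
    with n hCn hpn hout hlayers
  obtain ⟨hlarge, hvlarge⟩ := hCn (p n) hpn
  have hup := upStarFreeMoment_powerset_le (hp n).1 (hp n).2 hδ0 hδ1 hs hγ hout hlarge hvlarge
  set M : ℝ := (n.choose (n / 2) : ℝ) with hM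
  have hM0 : 0 ≤ M := by positivity
  have hpM0 : 0 ≤ p n * M := mul_nonneg (hp n).1 hM0
  set L := {a ∈ (range n).powerset | n / 2 ≤ #a ∧ #a < n / 2 + (h - 1)} with hL
  rw [Nat.cast_sub (by omega), Nat.cast_one] at hlayers
  have hlow := randSubsetExp_exp_neg_card_inter_le (A := (range n).powerset) (L := L)
    (hp n).1 (hp n).2 hs'0.le (min_le_left _ _) hs'q hε.le hM0 (filter_subset _ _) hlayers
  have key := one_sub_le_probFam (n := n) (p := p n) (s := s) (s' := s')
    (x := (1 + δ) * (p n * M)) (y := ((h : ℝ) - 1 - ε) * p n * M)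
    (z := ((h : ℝ) - 1 + ε) * p n * M) (hp n).1 (hp n).2 hh hs0.le hs'0.le L hT
    (fun G => card_inter_le_maxPthFreeSub ht fun a ha => (mem_filter.1 ha).2) (by
      have := mul_le_mul_of_nonneg_right hδε hpM0
      linarith)
  refine le_trans ?_ key
  have hup' : Real.exp (-(s * ((1 + δ) * (p n * M)))) *
      upStarFreeMoment (p n) s T (range n).powerset ≤ Real.exp (-(s * δ / 4 * (p n * M))) := by
    refine (mul_le_mul_of_nonneg_left hup (Real.exp_pos _).le).trans ?_
    rw [← Real.exp_add, Real.exp_le_exp]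
    linarith
  rw [← mul_assoc _ (p n) M] at hlow
  linarith
end

section
/- For all integers t ≥ 1 and h ≥ 2, the number of P_{t,h}-free families in 2^[n] is 2^{(h−1+o(1))·C(n,⌊n/2⌋)}: for every ε > 0 there is N such that for all n ≥ N, the number of P_{t,h}-free families F ⊆ 2^[n] lies between 2^{(h−1−ε)·C(n,⌊n/2⌋)} and 2^{(h−1+ε)·C(n,⌊n/2⌋)}. -/
open Finset

open scoped Classical in
/-- The number of `P_{t,h}`-free families `F ⊆ 2^[n]`. -/
noncomputable def numPthFree (n t h : ℕ) : ℕ :=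
  ((Finset.range n).powerset.powerset.filter fun F => PthFree t h F).card

/-- Every element of `F` has fewer than `M` out-neighbours in `F` under the relation `r`. -/
def OutDegreeLt {α : Type*} (r : α → α → Prop) [DecidableRel r] (M : ℕ) (F : Finset α) : Prop :=
  ∀ a ∈ F, #{b ∈ F | r a b} < M

instance {α : Type*} (r : α → α → Prop) [DecidableRel r] (M : ℕ) :
    DecidablePred (OutDegreeLt r M) := fun F => by
  unfold OutDegreeLt; infer_instance

lemma OutDegreeLt.mono {α : Type*} {r : α → α → Prop} [DecidableRel r] {M : ℕ} {F G : Finset α}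
    (hG : OutDegreeLt r M G) (h : F ⊆ G) : OutDegreeLt r M F := fun a ha =>
  (card_le_card (filter_subset_filter _ h)).trans_lt (hG a (h ha))

lemma card_powerset_filter_card_lt_le {α : Type*} (s : Finset α) (M : ℕ) :
    #{T ∈ s.powerset | #T < M} ≤ (#s + 1) ^ M := by
  classical
  calc #{T ∈ s.powerset | #T < M}
      ≤ #((range M).biUnion fun i => powersetCard i s) := by
        refine card_le_card fun T hT => ?_
        simp only [mem_filter, mem_powerset] at hT
        simp [mem_powersetCard, hT.1, hT.2]
    _ ≤ ∑ i ∈ range M, (#s) ^ i := by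
        refine card_biUnion_le.trans (sum_le_sum fun i _ => ?_)
        rw [card_powersetCard]
        exact Nat.choose_le_pow _ _
    _ ≤ (#s + 1) ^ M := by
        induction M with
        | zero => simp
        | succ M ih =>
          rw [sum_range_succ, pow_succ, mul_add_one, add_comm]
          have h1 : (#s) ^ M ≤ (#s + 1) ^ M * #s ∨ M = 0 ∨ #s = 0 := by
            rcases Nat.eq_zero_or_pos (#s) with h | h
            · simp [h]
            · left
              calc (#s) ^ M ≤ (#s + 1) ^ M := Nat.pow_le_pow_left (by omega) _
                _ ≤ _ := Nat.le_mul_of_pos_right _ h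
          rcases h1 with h1 | rfl | h1
          · exact add_le_add h1 ih
          · simp
          · rw [h1] at ih ⊢
            rcases M with _ | M
            · simp
            · simp

/-- A Kleitman–Winston type counting bound: if every subset of `V` of out-degree less than `Δ` has
at most `K` elements, then `V` has few subsets of out-degree less than `M`. -/
lemma card_filter_outDegreeLt_le {α : Type*} [DecidableEq α] (r : α → α → Prop) [DecidableRel r]
    (hr : ∀ a, ¬ r a a) (M Δ K : ℕ) (x : ℝ) (hx1 : 1 ≤ x)
    (hx : ∀ d : ℕ, Δ ≤ d → ((d : ℝ) + 1) ^ M ≤ (x - 1) * x ^ d) (V : Finset α)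
    (hK : ∀ S ⊆ V, OutDegreeLt r Δ S → #S ≤ K) :
    (#{F ∈ V.powerset | OutDegreeLt r M F} : ℝ) ≤ 2 ^ K * x ^ #V := by
  induction V using Finset.strongInduction with
  | H V ih =>
  have hx0 : 0 ≤ x := by linarith
  by_cases hV : OutDegreeLt r Δ V
  · calc (#{F ∈ V.powerset | OutDegreeLt r M F} : ℝ) ≤ (#V.powerset : ℝ) := by
          exact_mod_cast card_filter_le _ _
      _ = 2 ^ #V := by rw [card_powerset]; push_cast; rfl
      _ ≤ 2 ^ K := pow_le_pow_right₀ (by norm_num) (hK V Subset.rfl hV)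
      _ ≤ 2 ^ K * x ^ #V := le_mul_of_one_le_right (by positivity) (one_le_pow₀ hx1)
  · unfold OutDegreeLt at hV
    push Not at hV
    obtain ⟨a, haV, had⟩ := hV
    set N := V.filter (r a) with hN
    have haN : a ∉ N := by simp [hN, hr]
    have hNV : N ⊆ V.erase a := fun b hb => mem_erase.2
      ⟨fun h => haN (h ▸ hb), (mem_filter.1 hb).1⟩
    have hsub : V.powerset.filter (OutDegreeLt r M) ⊆
        (V.erase a).powerset.filter (OutDegreeLt r M) ∪
        ((N.powerset.filter (fun T => #T < M)) ×ˢ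
          (V.erase a \ N).powerset.filter (OutDegreeLt r M)).image
            (fun p => insert a (p.1 ∪ p.2)) := by
      intro F hF
      simp only [mem_filter, mem_powerset] at hF
      rw [mem_union]
      by_cases haF : a ∈ F
      · right
        rw [mem_image]
        refine ⟨(F ∩ N, F.erase a \ N), ?_, ?_⟩
        · simp only [mem_product, mem_filter, mem_powerset]
          refine ⟨⟨inter_subset_right, ?_⟩,
            sdiff_subset_sdiff (erase_subset_erase _ hF.1) Subset.rfl,
            hF.2.mono (sdiff_subset.trans (erase_subset _ _))⟩
          refine (card_le_card fun b hb => ?_).trans_lt (hF.2 a haF)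
          simp only [hN, mem_inter, mem_filter] at hb ⊢
          exact ⟨hb.1, hb.2.2⟩
        · ext b
          simp only [mem_insert, mem_union, mem_inter, mem_sdiff, mem_erase]
          by_cases hba : b = a
          · simp [hba, haF]
          · by_cases b ∈ N <;> simp_all
      · left
        simp only [mem_filter, mem_powerset]
        exact ⟨subset_erase.2 ⟨hF.1, haF⟩, hF.2⟩
    have h1 := ih (V.erase a) (erase_ssubset haV)
      (fun S hS => hK S (hS.trans (erase_subset _ _)))
    have h2 := ih (V.erase a \ N) (sdiff_subset.trans_ssubset (erase_ssubset haV))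
      (fun S hS => hK S (hS.trans (sdiff_subset.trans (erase_subset _ _))))
    have hcard : #V = #(V.erase a \ N) + #N + 1 := by
      rw [card_sdiff_add_card_eq_card hNV, card_erase_add_one haV]
    have hcard' : #(V.erase a) = #(V.erase a \ N) + #N := (card_sdiff_add_card_eq_card hNV).symm
    have h3 : (#(V.powerset.filter (OutDegreeLt r M)) : ℝ) ≤
        #((V.erase a).powerset.filter (OutDegreeLt r M)) + ((#N : ℝ) + 1) ^ M *
          #((V.erase a \ N).powerset.filter (OutDegreeLt r M)) := by
      have := (card_le_card hsub).trans ((card_union_le _ _).trans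
        (Nat.add_le_add_left (card_image_le.trans ((card_product _ _).le.trans
          (Nat.mul_le_mul_right _ (card_powerset_filter_card_lt_le N M)))) _))
      exact_mod_cast this
    have hd := hx #N had
    rw [hcard'] at h1
    rw [hcard]
    set m := #(V.erase a \ N)
    calc (#(V.powerset.filter (OutDegreeLt r M)) : ℝ)
        ≤ 2 ^ K * x ^ (m + #N) + ((x - 1) * x ^ #N) * (2 ^ K * x ^ m) := by
          refine h3.trans (add_le_add h1 (mul_le_mul hd h2 (by positivity) ?_))
          exact mul_nonneg (by linarith) (by positivity)
      _ = 2 ^ K * x ^ (m + #N + 1) := by ring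

lemma sum_card_filter_mem {α β : Type*} [Fintype β] [DecidableEq β] (s : Finset α)
    (p : α → Finset β) : ∑ b, #{a ∈ s | b ∈ p a} = ∑ a ∈ s, #(p a) := by
  simp_rw [card_filter]
  rw [sum_comm]
  simp

lemma le_choose_of_pos_of_lt {m k : ℕ} (hk : 0 < k) (hkm : k < m) : m ≤ m.choose k := by
  induction m generalizing k with
  | zero => omega
  | succ m ih =>
    obtain ⟨k, rfl⟩ := Nat.exists_eq_succ_of_ne_zero hk.ne'
    rcases Nat.lt_or_ge (k + 1) m with h | h
    · have h1 := ih (Nat.succ_pos k) h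
      have h2 : 0 < m.choose k := Nat.choose_pos (by omega)
      rw [Nat.succ_eq_add_one, Nat.choose_succ_succ']
      simp only [Nat.succ_eq_add_one] at h1
      omega
    · obtain rfl : m = k + 1 := by simp only [Nat.succ_eq_add_one] at hkm; omega
      simp

open Nat in
/-- Numberings in which two nested proper sets are both prefixes are rare among those in which
the smaller set is a prefix. -/
lemma sub_mul_card_prefixed_inter_le {X : Type*} [Fintype X] [DecidableEq X] {A B : Finset X}
    (hAB : A ⊂ B) (hB : B ≠ univ) :
    (Fintype.card X - #A) * #(Numbering.prefixed A ∩ Numbering.prefixed B) ≤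
      #(Numbering.prefixed A) := by
  set C : Finset ↑(Aᶜ) := B.subtype (· ∈ Aᶜ) with hC
  have hcC : #C = #B - #A := by
    rw [hC, card_subtype, ← card_sdiff_of_subset hAB.subset]
    congr 1
    ext x; simp
  have hlt : #A < #B := card_lt_card hAB
  have hltn : #B < Fintype.card X := (card_lt_iff_ne_univ B).2 hB
  have hinj : #(Numbering.prefixed A ∩ Numbering.prefixed B) ≤
      #((univ : Finset (Numbering A)) ×ˢ Numbering.prefixed C) := by
    refine card_le_card_of_injOn
      (fun f => if h : f ∈ Numbering.prefixed A then Numbering.prefixedEquiv A ⟨f, h⟩ else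
        (Fintype.equivFin _, Fintype.equivFin _)) ?_ ?_
    · intro f hf
      obtain ⟨hfA, hfB⟩ := mem_inter.1 (mem_coe.1 hf)
      simp only [hfA, dite_true, coe_product, Set.mem_prod, coe_univ, Set.mem_univ, true_and,
        mem_coe, Numbering.mem_prefixed]
      intro x
      have hxA := (Numbering.mem_prefixed.1 hfA x).not.1 (mem_compl.1 x.2)
      have hxB := Numbering.mem_prefixed.1 hfB x
      have : (((Numbering.prefixedEquiv A ⟨f, hfA⟩).2 x : Fin _) : ℕ) = f x - #A := rfl
      rw [this, hcC, hC, mem_subtype, hxB]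
      omega
    · intro f hf g hg hfg
      have hfA := (mem_inter.1 (mem_coe.1 hf)).1
      have hgA := (mem_inter.1 (mem_coe.1 hg)).1
      simp only [hfA, hgA, dite_true] at hfg
      simpa using (Numbering.prefixedEquiv A).injective hfg
  have hcA : Fintype.card ↑(Aᶜ) = Fintype.card X - #A := by simp
  rw [card_product, Finset.card_univ, Fintype.card_numbering, Numbering.card_prefixed,
    Fintype.card_coe, hcC, hcA] at hinj
  rw [Numbering.card_prefixed]
  set n := Fintype.card X
  have hch := Nat.choose_mul_factorial_mul_factorial (show #B - #A ≤ n - #A by omega)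
  have hge : n - #A ≤ (n - #A).choose (#B - #A) :=
    le_choose_of_pos_of_lt (by omega) (by omega)
  calc (n - #A) * #(Numbering.prefixed A ∩ Numbering.prefixed B)
      ≤ (n - #A).choose (#B - #A) * ((#A)! * ((#B - #A)! * (n - #A - (#B - #A))!)) := by gcongr
    _ = (#A)! * ((n - #A).choose (#B - #A) * (#B - #A)! * (n - #A - (#B - #A))!) := by ring
    _ = _ := by rw [hch]

open Numbering in
/-- A supersaturated form of the LYM inequality. -/
lemma card_mul_le_of_outDegree_le {X : Type*} [Fintype X] [DecidableEq X]
    (S : Finset (Finset X)) (m : ℕ) (η : ℝ) (hm : 0 < m) (hS : ∀ A ∈ S, #A + m ≤ Fintype.card X)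
    (hdeg : ∀ A ∈ S, (#{B ∈ S | A ⊂ B} : ℝ) ≤ η * m) :
    (1 - η) * #S ≤ ((Fintype.card X).choose (Fintype.card X / 2) : ℝ) := by
  classical
  set n := Fintype.card X with hn
  set N := n.choose (n / 2)
  have hchain : ∀ f : Numbering X, #{A ∈ S | f ∈ prefixed A} ≤
      1 + ∑ A ∈ S, #{B ∈ S | A ⊂ B ∧ f ∈ prefixed A ∩ prefixed B} := by
    intro f
    set T := S.filter (fun A => f ∈ prefixed A) with hT
    rcases T.eq_empty_or_nonempty with h | h
    · simp [h]
    obtain ⟨A, hA, hmin⟩ := exists_min_image T card h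
    have hAS := (mem_filter.1 hA).1
    have hAf := (mem_filter.1 hA).2
    have h1 : #(T.erase A) ≤ #{B ∈ S | A ⊂ B ∧ f ∈ prefixed A ∩ prefixed B} := by
      refine card_le_card fun B hB => ?_
      obtain ⟨hBA, hBT⟩ := mem_erase.1 hB
      obtain ⟨hBS, hBf⟩ := mem_filter.1 hBT
      refine mem_filter.2 ⟨hBS, ?_, mem_inter.2 ⟨hAf, hBf⟩⟩
      exact (IsPrefix.subset_of_card_le_card (mem_prefixed.1 hAf) (mem_prefixed.1 hBf)
        (hmin B hBT)).ssubset_of_ne hBA.symm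
    have h2 := single_le_sum
      (f := fun A => #{B ∈ S | A ⊂ B ∧ f ∈ prefixed A ∩ prefixed B})
      (fun _ _ => Nat.zero_le _) hAS
    have h3 := card_erase_add_one hA
    omega
  have hsum : ∑ A ∈ S, #(prefixed A) ≤
      n.factorial + ∑ A ∈ S, ∑ B ∈ S with A ⊂ B, #(prefixed A ∩ prefixed B) := by
    calc ∑ A ∈ S, #(prefixed A) = ∑ f : Numbering X, #{A ∈ S | f ∈ prefixed A} :=
          (sum_card_filter_mem _ _).symm
      _ ≤ ∑ f : Numbering X,
          (1 + ∑ A ∈ S, #{B ∈ S | A ⊂ B ∧ f ∈ prefixed A ∩ prefixed B}) :=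
          sum_le_sum fun f _ => hchain f
      _ = _ := by
          rw [sum_add_distrib, sum_comm]
          congr 1
          · simp [Fintype.card_numbering, hn]
          · refine sum_congr rfl fun A _ => ?_
            simp_rw [← filter_filter]
            exact sum_card_filter_mem _ _
  have hpair : ∀ A ∈ S, (∑ B ∈ S with A ⊂ B, (#(prefixed A ∩ prefixed B) : ℝ)) ≤
      η * #(prefixed A) := by
    intro A hA
    have hm' : (0 : ℝ) < m := by exact_mod_cast hm
    have h1 : ∀ B ∈ S.filter (A ⊂ ·), (#(prefixed A ∩ prefixed B) : ℝ) ≤ #(prefixed A) / m := by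
      intro B hB
      obtain ⟨hBS, hAB⟩ := mem_filter.1 hB
      have hBu : B ≠ univ := by
        rintro rfl
        have := hS _ hBS
        rw [card_univ] at this
        omega
      rw [le_div_iff₀ hm']
      have h := sub_mul_card_prefixed_inter_le hAB hBu
      have h' : m ≤ n - #A := by have := hS A hA; omega
      have := (Nat.mul_le_mul_right #(prefixed A ∩ prefixed B) h').trans h
      rw [mul_comm]
      exact_mod_cast this
    calc _ ≤ ∑ B ∈ S with A ⊂ B, (#(prefixed A) : ℝ) / m := sum_le_sum h1
      _ = #{B ∈ S | A ⊂ B} * ((#(prefixed A) : ℝ) / m) := by rw [sum_const, nsmul_eq_mul]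
      _ ≤ (η * m) * ((#(prefixed A) : ℝ) / m) := by gcongr; exact hdeg A hA
      _ = η * #(prefixed A) := by field_simp
  have hsum' : (1 - η) * ∑ A ∈ S, (#(prefixed A) : ℝ) ≤ n.factorial := by
    have h1 : ∑ A ∈ S, (#(prefixed A) : ℝ) ≤
      n.factorial + ∑ A ∈ S, ∑ B ∈ S with A ⊂ B, (#(prefixed A ∩ prefixed B) : ℝ) := by
      exact_mod_cast hsum
    have h2 := sum_le_sum hpair
    rw [← mul_sum] at h2
    linarith
  rcases le_or_gt (1 - η) 0 with hη | hη
  · exact (mul_nonpos_of_nonpos_of_nonneg hη (by positivity)).trans (by positivity)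
  have hlow : ∀ A ∈ S, (n.factorial : ℝ) ≤ N * #(prefixed A) := by
    intro A hA
    have h1 := Nat.choose_mul_factorial_mul_factorial (card_le_univ A)
    rw [mul_assoc, ← card_prefixed] at h1
    have h2 := Nat.mul_le_mul_right #(prefixed A) (Nat.choose_le_middle #A n)
    rw [h1] at h2
    exact_mod_cast h2
  have hfac : (0 : ℝ) < n.factorial := by exact_mod_cast n.factorial_pos
  have h4 : (#S : ℝ) * n.factorial ≤ N * ∑ A ∈ S, (#(prefixed A) : ℝ) := by
    rw [mul_sum, ← nsmul_eq_mul]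
    exact card_nsmul_le_sum _ _ _ hlow
  refine le_of_mul_le_mul_right ?_ hfac
  calc (1 - η) * #S * n.factorial = (1 - η) * (#S * n.factorial) := by ring
    _ ≤ (1 - η) * (N * ∑ A ∈ S, (#(prefixed A) : ℝ)) := by gcongr
    _ = N * ((1 - η) * ∑ A ∈ S, (#(prefixed A) : ℝ)) := by ring
    _ ≤ N * n.factorial := by gcongr

/-- The supersaturated LYM inequality for families of subsets of `range n`. -/
lemma card_mul_le_of_outDegree_le_range (n m : ℕ) (η : ℝ) (hm : 0 < m)
    (S : Finset (Finset ℕ)) (hSn : S ⊆ (range n).powerset) (hS : ∀ A ∈ S, #A + m ≤ n)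
    (hdeg : ∀ A ∈ S, (#{B ∈ S | A ⊂ B} : ℝ) ≤ η * m) :
    (1 - η) * #S ≤ (n.choose (n / 2) : ℝ) := by
  classical
  set e : Finset (Fin n) → Finset ℕ := fun A => A.map Fin.valEmbedding with he
  have heinj : Function.Injective e := map_injective _
  set T : Finset (Finset (Fin n)) := univ.filter (fun A => e A ∈ S) with hT
  have hcard : #T = #S := by
    refine card_bij (fun A _ => e A) (fun A hA => (mem_filter.1 hA).2)
      (fun A _ B _ h => heinj h) fun B hB => ?_
    have hBn := mem_powerset.1 (hSn hB)
    have h : e (B.attachFin fun i hi => mem_range.1 (hBn hi)) = B := by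
      ext i
      simp only [he, mem_map, mem_attachFin, Fin.valEmbedding_apply]
      exact ⟨fun ⟨a, ha, h⟩ => h ▸ ha, fun hi => ⟨⟨i, mem_range.1 (hBn hi)⟩, hi, rfl⟩⟩
    exact ⟨_, by rw [hT, mem_filter, h]; exact ⟨mem_univ _, hB⟩, h⟩
  have := card_mul_le_of_outDegree_le T m η hm
    (fun A hA => by simpa [he] using hS _ (mem_filter.1 hA).2) (fun A hA => by
      refine le_trans ?_ (hdeg _ (mem_filter.1 hA).2)
      norm_cast
      refine card_le_card_of_injOn e (fun B hB => ?_) heinj.injOn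
      obtain ⟨hBT, hAB⟩ := mem_filter.1 (mem_coe.1 hB)
      exact mem_coe.2 (mem_filter.2 ⟨(mem_filter.1 hBT).2, map_ssubset_map.2 hAB⟩))
  simpa [hcard] using this

/-- `richLevel M F k` consists of the members of `F` from which one can climb `k` times in `F`,
having at least `M` choices at each step. -/
def richLevel (M : ℕ) (F : Finset (Finset ℕ)) : ℕ → Finset (Finset ℕ)
  | 0 => F
  | k + 1 => {A ∈ richLevel M F k | M ≤ #{B ∈ richLevel M F k | A ⊂ B}}

lemma richLevel_succ_subset (M : ℕ) (F : Finset (Finset ℕ)) (k : ℕ) :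
    richLevel M F (k + 1) ⊆ richLevel M F k := filter_subset _ _

lemma richLevel_subset (M : ℕ) (F : Finset (Finset ℕ)) (k : ℕ) : richLevel M F k ⊆ F := by
  induction k with
  | zero => exact Subset.rfl
  | succ k ih => exact (richLevel_succ_subset M F k).trans ih

lemma outDegreeLt_richLevel_sdiff (M : ℕ) (F : Finset (Finset ℕ)) (k : ℕ) :
    OutDegreeLt (· ⊂ ·) M (richLevel M F k \ richLevel M F (k + 1)) := by
  intro A hA
  obtain ⟨hA1, hA2⟩ := mem_sdiff.1 hA
  by_contra h
  refine hA2 (mem_filter.2 ⟨hA1, (not_lt.1 h).trans (card_le_card ?_)⟩)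
  exact filter_subset_filter _ sdiff_subset

lemma exists_embedding_of_mem_richLevel {α : Type*} [DecidableEq α] {M H : ℕ}
    {F : Finset (Finset ℕ)} {R : Finset ℕ} (hR : R ∈ richLevel M F H) (D : Finset (List α))
    (hcard : #D ≤ M) (hlen : ∀ l ∈ D, l.length ≤ H)
    (hpre : ∀ l ∈ D, ∀ l', l' <+: l → l' ∈ D) :
    ∃ φ : List α → Finset ℕ, Set.InjOn φ D ∧ (∀ l ∈ D, φ l ∈ richLevel M F (H - l.length)) ∧
      ∀ l ∈ D, ∀ l' ∈ D, l <+: l' → φ l ⊆ φ l' := by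
  induction D using Finset.induction_on_max_value (List.length (α := α)) with
  | empty => exact ⟨fun _ => ∅, by simp⟩
  | insert a s has hmax ih =>
    have hnot : ∀ l ∈ s, ¬ a <+: l := fun l hl h =>
      has (h.eq_of_length_le (hmax l hl) ▸ hl)
    have hpre' : ∀ l ∈ s, ∀ l', l' <+: l → l' ∈ s := fun l hl l' hl' => by
      rcases mem_insert.1 (hpre l (mem_insert_of_mem hl) l' hl') with rfl | h
      · exact absurd hl' (hnot l hl)
      · exact h
    obtain ⟨φ, hinj, hmem, hmono⟩ := ih ((card_le_card (subset_insert a s)).trans hcard)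
      (fun l (hl : l ∈ s) => hlen l (mem_insert_of_mem hl)) hpre'
    obtain ⟨B, hB, hBs, hBsub⟩ : ∃ B ∈ richLevel M F (H - a.length), B ∉ s.image φ ∧
        ∀ l ∈ s, l <+: a → φ l ⊆ B := by
      rcases List.eq_nil_or_concat a with rfl | ⟨p, c, rfl⟩
      · have hs : s = ∅ := eq_empty_of_forall_notMem fun l hl => hnot l hl List.nil_prefix
        exact ⟨R, by simpa using hR, by simp [hs], by simp [hs]⟩
      · have hps : p ∈ s := by
          rcases mem_insert.1 (hpre _ (mem_insert_self _ _) p (by simp)) with h | h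
          · simpa using congrArg List.length h
          · exact h
        have hl := hlen _ (mem_insert_self _ _)
        simp only [List.concat_eq_append, List.length_append, List.length_cons,
          List.length_nil] at hl
        have hp := hmem p hps
        rw [show H - p.length = (H - (p.length + 1)) + 1 by omega] at hp
        have hpM := (mem_filter.1 hp).2
        have hlt : #(s.image φ) < #{B ∈ richLevel M F (H - (p.length + 1)) | φ p ⊂ B} := by
          rw [card_insert_of_notMem has] at hcard
          have := card_image_le (s := s) (f := φ)
          omega
        obtain ⟨B, hB, hBs⟩ := exists_mem_notMem_of_card_lt_card hlt
        obtain ⟨hB, hpB⟩ := mem_filter.1 hB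
        refine ⟨B, by simpa using hB, hBs, fun l hls hla => ?_⟩
        rw [List.concat_eq_append, List.prefix_concat_iff] at hla
        rcases hla with rfl | hla
        · exact absurd hls (by simpa using has)
        · exact (hmono l hls p hps hla).trans hpB.subset
    have hne : ∀ l ∈ s, l ≠ a := fun l hl h => has (h ▸ hl)
    refine ⟨Function.update φ a B, ?_, ?_, ?_⟩
    · rw [coe_insert, Set.injOn_insert (by simpa using has)]
      refine ⟨hinj.congr fun l hl => (Function.update_of_ne (hne l hl) _ _).symm, ?_⟩
      rintro ⟨l, hl, h⟩
      rw [Function.update_self, Function.update_of_ne (hne l hl)] at h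
      exact hBs (mem_image.2 ⟨l, hl, h⟩)
    · intro l hl
      rcases mem_insert.1 hl with rfl | hl
      · simpa using hB
      · rw [Function.update_of_ne (hne l hl)]
        exact hmem l hl
    · intro l hl l' hl' hll
      rcases mem_insert.1 hl with rfl | hls <;> rcases mem_insert.1 hl' with rfl | hls'
      · exact Subset.rfl
      · exact absurd hll (hnot l' hls')
      · rw [Function.update_self, Function.update_of_ne (hne l hls)]
        exact hBsub l hls hll
      · rw [Function.update_of_ne (hne l hls), Function.update_of_ne (hne l' hls')]
        exact hmono l hls l' hls' hll

/-- The set of vertices of `P_{t,h}` as a finite set of lists. -/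
noncomputable def treeVerts (t h : ℕ) : Finset (List (Fin t)) :=
  (List.finite_length_le (Fin t) (h - 1)).toFinset

lemma mem_treeVerts {t h : ℕ} {l : List (Fin t)} : l ∈ treeVerts t h ↔ l.length ≤ h - 1 := by
  simp [treeVerts]

lemma PthFree.richLevel_eq_empty {t h : ℕ} {F : Finset (Finset ℕ)} (hF : PthFree t h F) :
    richLevel #(treeVerts t h) F (h - 1) = ∅ := by
  by_contra hne
  obtain ⟨R, hR⟩ := nonempty_iff_ne_empty.2 hne
  obtain ⟨φ, hinj, hmem, hmono⟩ := exists_embedding_of_mem_richLevel hR (treeVerts t h) le_rfl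
    (fun l hl => mem_treeVerts.1 hl)
    (fun l hl l' hl' => mem_treeVerts.2 (hl'.length_le.trans (mem_treeVerts.1 hl)))
  refine hF ⟨fun v => φ v.1, fun v w hvw => ?_, fun v => ?_, fun v w hvw => ?_⟩
  · exact Subtype.ext (hinj (mem_treeVerts.2 v.2) (mem_treeVerts.2 w.2) hvw)
  · exact richLevel_subset _ _ _ (hmem _ (mem_treeVerts.2 v.2))
  · exact hmono _ (mem_treeVerts.2 v.2) _ (mem_treeVerts.2 w.2) hvw

lemma biUnion_richLevel_sdiff {M H : ℕ} {F : Finset (Finset ℕ)} (hF : richLevel M F H = ∅) :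
    (univ : Finset (Fin H)).biUnion
      (fun k => richLevel M F k \ richLevel M F (k + 1)) = F := by
  refine Subset.antisymm (biUnion_subset.2 fun k _ => sdiff_subset.trans (richLevel_subset _ _ _))
    fun A hA => ?_
  have hex : ∃ k, A ∉ richLevel M F k := ⟨H, by simp [hF]⟩
  classical
  have hspec := Nat.find_spec hex
  have hle : Nat.find hex ≤ H := Nat.find_min' hex (by simp [hF])
  obtain ⟨k, hk⟩ : ∃ k, Nat.find hex = k + 1 := by
    refine Nat.exists_eq_succ_of_ne_zero fun h0 => ?_
    rw [h0] at hspec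
    exact hspec hA
  have hmin := Nat.find_min hex (show k < Nat.find hex by omega)
  rw [hk] at hspec
  exact mem_biUnion.2 ⟨⟨k, by omega⟩, mem_univ _, mem_sdiff.2 ⟨not_not.1 hmin, hspec⟩⟩

/-- Splitting a `P_{t,h}`-free family into `h - 1` families of bounded out-degree. -/
lemma numPthFree_le_pow (n t h : ℕ) : numPthFree n t h ≤
    #{F ∈ (range n).powerset.powerset | OutDegreeLt (· ⊂ ·) #(treeVerts t h) F} ^ (h - 1) := by
  classical
  set M := #(treeVerts t h)
  set G := (range n).powerset.powerset.filter (OutDegreeLt (· ⊂ ·) M) with hG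
  have hc : #(Fintype.piFinset fun _ : Fin (h - 1) => G) = #G ^ (h - 1) := by simp
  rw [← hc, numPthFree]
  refine card_le_card_of_injOn
    (fun F k => richLevel M F k \ richLevel M F (k + 1)) (fun F hF => ?_) ?_
  · simp only [mem_coe, mem_filter, mem_powerset] at hF
    refine mem_coe.2 (Fintype.mem_piFinset.2 fun k => mem_filter.2 ⟨mem_powerset.2 ?_, ?_⟩)
    · exact sdiff_subset.trans ((richLevel_subset _ _ _).trans hF.1)
    · exact outDegreeLt_richLevel_sdiff _ _ _
  · intro F hF F' hF' h
    simp only [mem_coe, mem_filter] at hF hF'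
    rw [← biUnion_richLevel_sdiff hF.2.richLevel_eq_empty,
      ← biUnion_richLevel_sdiff hF'.2.richLevel_eq_empty]
    exact congrArg _ h

/-- The union of `H` consecutive layers of `2^[n]`, starting with the middle one. -/
def middleLayers (n H : ℕ) : Finset (Finset ℕ) :=
  (range H).biUnion fun i => powersetCard (n / 2 + i) (range n)

lemma card_middleLayers (n H : ℕ) :
    #(middleLayers n H) = ∑ i ∈ range H, n.choose (n / 2 + i) := by
  rw [middleLayers, card_biUnion]
  · simp
  · intro i _ j _ hij
    refine disjoint_left.2 fun A hA hA' => hij ?_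
    have := (mem_powersetCard.1 hA).2
    have := (mem_powersetCard.1 hA').2
    omega

lemma pthFree_of_subset_middleLayers {n t h : ℕ} (ht : 1 ≤ t)
    {F : Finset (Finset ℕ)} (hF : F ⊆ middleLayers n (h - 1)) : PthFree t h F := by
  rintro ⟨φ, hinj, hmem, hmono⟩
  have hcard : ∀ v, n / 2 ≤ #(φ v) ∧ #(φ v) < n / 2 + (h - 1) := by
    intro v
    obtain ⟨i, hi, hA⟩ := mem_biUnion.1 (hF (hmem v))
    have := (mem_powersetCard.1 hA).2
    have := mem_range.1 hi
    omega
  set c : Fin t := ⟨0, ht⟩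
  have hstep : ∀ i (hi : i ≤ h - 1),
      n / 2 + i ≤ #(φ ⟨List.replicate i c, by simpa using hi⟩) := by
    intro i
    induction i with
    | zero => intro _; exact (hcard _).1
    | succ i ih =>
      intro hi
      have hlt : #(φ ⟨List.replicate i c, by simp; omega⟩) <
          #(φ ⟨List.replicate (i + 1) c, by simpa using hi⟩) := by
        refine card_lt_card ((hmono _ _ ?_).ssubset_of_ne fun heq => ?_)
        · exact ⟨[c], by simp [List.replicate_succ']⟩
        · have := congrArg (fun v => v.1.length) (hinj heq)
          simp at this
      have := ih (by omega)
      omega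
  have h1 := hstep (h - 1) le_rfl
  have h2 := (hcard ⟨List.replicate (h - 1) c, by simp⟩).2
  omega

lemma two_pow_le_numPthFree {n t h : ℕ} (ht : 1 ≤ t) :
    2 ^ (∑ i ∈ range (h - 1), n.choose (n / 2 + i)) ≤ numPthFree n t h := by
  classical
  rw [← card_middleLayers, ← card_powerset, numPthFree]
  refine card_le_card fun F hF => mem_filter.2 ⟨mem_powerset.2 ?_,
    pthFree_of_subset_middleLayers ht (mem_powerset.1 hF)⟩
  refine (mem_powerset.1 hF).trans (biUnion_subset.2 fun i _ A hA => ?_)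
  exact mem_powerset.2 (mem_powersetCard.1 hA).1

lemma sixteen_pow_le_mul_centralBinom_sq {m : ℕ} (hm : 0 < m) :
    16 ^ m ≤ 4 * m * m.centralBinom ^ 2 := by
  induction m, hm using Nat.le_induction with
  | base => simp [Nat.centralBinom, Nat.choose]
  | succ m hm ih =>
    have h := Nat.succ_mul_centralBinom_succ m
    refine Nat.le_of_mul_le_mul_left (c := m + 1) ?_ (by omega)
    calc (m + 1) * 16 ^ (m + 1) = 16 * (m + 1) * 16 ^ m := by ring
      _ ≤ 16 * (m + 1) * (4 * m * m.centralBinom ^ 2) := by gcongr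
      _ = (64 * m * (m + 1)) * m.centralBinom ^ 2 := by ring
      _ ≤ (16 * (2 * m + 1) ^ 2) * m.centralBinom ^ 2 :=
          Nat.mul_le_mul_right _ (by nlinarith)
      _ = 4 * (2 * (2 * m + 1) * m.centralBinom) ^ 2 := by ring
      _ = 4 * ((m + 1) * (m + 1).centralBinom) ^ 2 := by rw [h]
      _ = _ := by ring

lemma four_pow_le_mul_choose_half_sq {n : ℕ} (hn : 0 < n) :
    4 ^ n ≤ 4 * n * n.choose (n / 2) ^ 2 := by
  rcases Nat.even_or_odd' n with ⟨m, rfl | rfl⟩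
  · have h := sixteen_pow_le_mul_centralBinom_sq (m := m) (by omega)
    rw [Nat.centralBinom] at h
    rw [Nat.mul_div_cancel_left m (by norm_num), pow_mul]
    norm_num
    nlinarith
  · have h := sixteen_pow_le_mul_centralBinom_sq (m := m + 1) (by omega)
    have h2 : (m + 1).centralBinom = 2 * (2 * m + 1).choose m := by
      rw [Nat.centralBinom, show 2 * (m + 1) = 2 * m + 1 + 1 by ring, Nat.choose_succ_succ',
        Nat.choose_symm_half]
      ring
    rw [show (2 * m + 1) / 2 = m by omega]
    rw [h2] at h
    have h3 : 4 * 4 ^ (2 * m + 1) = 16 ^ (m + 1) := by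
      rw [← pow_succ', show 2 * m + 1 + 1 = 2 * (m + 1) by ring, pow_mul]; norm_num
    have h4 : 0 ≤ m * (2 * m + 1).choose m ^ 2 := Nat.zero_le _
    nlinarith

lemma two_pow_le_sqrt_mul_choose_half {n : ℕ} (hn : 0 < n) :
    (2 : ℝ) ^ n ≤ 2 * √n * n.choose (n / 2) := by
  refine le_of_sq_le_sq ?_ (by positivity)
  rw [mul_pow, mul_pow, Real.sq_sqrt (by positivity), ← pow_mul, mul_comm n 2, pow_mul]
  norm_num
  exact_mod_cast four_pow_le_mul_choose_half_sq hn

/-- `(1 + c / √d) ^ d` eventually dominates every polynomial in `d`. -/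
lemma exists_pow_le_mul_one_add_pow (M : ℕ) {c : ℝ} (hc : 0 < c) (hc1 : c ≤ 1) :
    ∃ d₀ : ℕ, 0 < d₀ ∧ ∀ d : ℕ, d₀ ≤ d →
      ((d : ℝ) + 1) ^ M ≤ c / √d * (1 + c / √d) ^ d := by
  have h1 := (isLittleO_pow_exp_pos_mul_atTop (2 * M + 1) (half_pos hc)).bound
    (show 0 < c / 2 ^ M by positivity)
  have h2 : Filter.Tendsto (fun d : ℕ => √(d : ℝ)) Filter.atTop Filter.atTop :=
    Real.tendsto_sqrt_atTop.comp tendsto_natCast_atTop_atTop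
  obtain ⟨d₀, hd₀⟩ := Filter.eventually_atTop.1 (h2.eventually h1)
  refine ⟨d₀ + 1, by omega, fun d hd => ?_⟩
  have h := hd₀ d (by omega)
  have hd1 : (1 : ℝ) ≤ d := by exact_mod_cast (by omega : 1 ≤ d)
  have hy1 : 1 ≤ √(d : ℝ) := Real.one_le_sqrt.2 hd1
  have hyd : √(d : ℝ) ^ 2 = d := Real.sq_sqrt (by positivity)
  set y := √(d : ℝ) with hy
  have hy0 : 0 < y := by linarith
  rw [Real.norm_of_nonneg (by positivity), Real.norm_of_nonneg (by positivity)] at h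
  have hexp : Real.exp (c / 2 * y) ≤ (1 + c / y) ^ d := by
    have hz : c / y ≤ 1 := (div_le_one hy0).2 (hc1.trans hy1)
    have hz0 : 0 < c / y := by positivity
    have : Real.exp (c / y / 2) ≤ 1 + c / y := by
      have h5 := Real.abs_exp_sub_one_sub_id_le (x := c / y / 2)
        (by rw [abs_le]; constructor <;> linarith)
      have h6 := (abs_le.1 h5).2
      nlinarith
    calc Real.exp (c / 2 * y) = Real.exp (d * (c / y / 2)) := by
          congr 1; rw [← hyd]; field_simp
      _ = Real.exp (c / y / 2) ^ d := by rw [Real.exp_nat_mul]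
      _ ≤ _ := by gcongr
  calc ((d : ℝ) + 1) ^ M ≤ (2 * y ^ 2) ^ M := by gcongr; linarith
    _ = 2 ^ M * y ^ (2 * M + 1) / y := by
        rw [mul_pow, ← pow_mul, pow_succ]; field_simp
    _ ≤ 2 ^ M * (c / 2 ^ M * Real.exp (c / 2 * y)) / y := by gcongr
    _ = c / y * Real.exp (c / 2 * y) := by field_simp
    _ ≤ _ := by gcongr

/-- The subsets of `range n` of size at least `3 * n / 4`. -/
def largeSets (n : ℕ) : Finset (Finset ℕ) := {A ∈ (range n).powerset | 3 * n ≤ 4 * #A}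

lemma card_largeSets_le (n : ℕ) : (#(largeSets n) : ℝ) ≤ (9 / 5 : ℝ) ^ n := by
  set k := (3 * n + 3) / 4 with hk
  have h1 : #(largeSets n) * 2 ^ k ≤ 3 ^ n := by
    calc #(largeSets n) * 2 ^ k ≤ ∑ A ∈ largeSets n, 2 ^ #A := by
          rw [← smul_eq_mul]
          refine card_nsmul_le_sum _ _ _ fun A hA => Nat.pow_le_pow_right (by norm_num) ?_
          have := (mem_filter.1 hA).2
          omega
      _ ≤ ∑ A ∈ (range n).powerset, 2 ^ #A * 1 ^ (#(range n) - #A) := by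
          simp only [one_pow, mul_one]
          exact sum_le_sum_of_subset (filter_subset _ _)
      _ = 3 ^ n := by rw [sum_pow_mul_eq_add_pow]; simp
  have h2 : (8 : ℕ) ^ n ≤ (2 ^ k) ^ 4 := by
    rw [← pow_mul, show 8 = 2 ^ 3 by norm_num, ← pow_mul]
    exact Nat.pow_le_pow_right (by norm_num) (by omega)
  have h3 : #(largeSets n) ^ 4 * 8 ^ n ≤ 81 ^ n := by
    calc _ ≤ #(largeSets n) ^ 4 * (2 ^ k) ^ 4 := by gcongr
      _ = (#(largeSets n) * 2 ^ k) ^ 4 := by ring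
      _ ≤ (3 ^ n) ^ 4 := by gcongr
      _ = 81 ^ n := by rw [← pow_mul, mul_comm, pow_mul]; norm_num
  have h4 : (#(largeSets n) : ℝ) ^ 4 * 8 ^ n ≤ 81 ^ n := by exact_mod_cast h3
  refine le_of_pow_le_pow_left₀ (n := 4) (by norm_num) (by positivity) ?_
  refine le_of_mul_le_mul_right (h4.trans ?_) (show (0 : ℝ) < 8 ^ n by positivity)
  rw [← pow_mul, mul_comm n 4, pow_mul, ← mul_pow]
  gcongr
  norm_num

lemma eventually_card_largeSets_le {ε : ℝ} (hε : 0 < ε) :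
    ∀ᶠ n : ℕ in Filter.atTop, (#(largeSets n) : ℝ) ≤ ε * n.choose (n / 2) := by
  have h := tendsto_self_mul_const_pow_of_lt_one (r := 9 / 10) (by norm_num) (by norm_num)
  filter_upwards [h.eventually (eventually_le_nhds (show 0 < ε / 2 by positivity)),
    Filter.eventually_ge_atTop 1] with n hn hn1
  have h1 := two_pow_le_sqrt_mul_choose_half hn1
  have hn1' : (1 : ℝ) ≤ n := by exact_mod_cast hn1
  have h2 : √(n : ℝ) ≤ n := Real.sqrt_le_iff.2 ⟨by positivity, by nlinarith⟩
  have h3 : (2 : ℝ) ^ n ≤ 2 * n * n.choose (n / 2) := h1.trans (by gcongr)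
  have hnpos : (0 : ℝ) < n := by linarith
  calc (#(largeSets n) : ℝ) ≤ (9 / 5 : ℝ) ^ n := card_largeSets_le n
    _ = (9 / 10) ^ n * 2 ^ n := by rw [← mul_pow]; norm_num
    _ ≤ (9 / 10) ^ n * (2 * n * n.choose (n / 2)) := by gcongr
    _ = 2 * (n * (9 / 10) ^ n) * n.choose (n / 2) := by ring
    _ ≤ 2 * (ε / 2) * n.choose (n / 2) := by gcongr
    _ = _ := by ring

lemma eventually_choose_half_add_ge (i : ℕ) {ε : ℝ} (hε : 0 < ε) :
    ∀ᶠ n : ℕ in Filter.atTop,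
      (1 - ε) * (n.choose (n / 2) : ℝ) ≤ n.choose (n / 2 + i) := by
  induction i generalizing ε with
  | zero =>
    refine Filter.Eventually.of_forall fun n => ?_
    have : (0 : ℝ) ≤ n.choose (n / 2) := by positivity
    simp only [add_zero]
    nlinarith
  | succ i ih =>
    filter_upwards [ih (half_pos hε), Filter.eventually_ge_atTop (2 * i + 2),
      tendsto_natCast_atTop_atTop.eventually_ge_atTop ((8 * i + 8) / ε)] with n hn hni hnε
    rw [div_le_iff₀ hε] at hnε
    have hN : (0 : ℝ) ≤ n.choose (n / 2) := by positivity
    rcases le_or_gt 1 ε with h1 | h1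
    · exact (mul_nonpos_of_nonpos_of_nonneg (by linarith) hN).trans (by positivity)
    have h := Nat.choose_succ_right_eq n (n / 2 + i)
    have hle : n / 2 + i ≤ n := by omega
    have h' : (n.choose (n / 2 + (i + 1)) : ℝ) * ((n / 2 : ℕ) + i + 1) =
        n.choose (n / 2 + i) * (n - ((n / 2 : ℕ) + i)) := by
      have := congrArg (Nat.cast : ℕ → ℝ) h
      push_cast [Nat.cast_sub hle] at this
      simpa [add_assoc] using this
    have e1 : (n : ℝ) ≤ 2 * (n / 2 : ℕ) + 1 := by exact_mod_cast (by omega : n ≤ 2 * (n / 2) + 1)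
    have e2 : 2 * ((n / 2 : ℕ) : ℝ) ≤ n := by exact_mod_cast (by omega : 2 * (n / 2) ≤ n)
    set a : ℝ := ((n / 2 : ℕ) : ℝ)
    have hi : (0 : ℝ) ≤ i := by positivity
    have ha : 0 ≤ a := by positivity
    have e3 : (1 - ε / 2) * (a + i + 1) ≤ n - (a + i) := by nlinarith
    refine le_of_mul_le_mul_right ?_ (show 0 < a + i + 1 by linarith)
    rw [h']
    calc (1 - ε) * (n.choose (n / 2) : ℝ) * (a + i + 1)
        ≤ ((1 - ε / 2) * n.choose (n / 2)) * ((1 - ε / 2) * (a + i + 1)) := by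
          have : 0 ≤ (ε / 2) ^ 2 * ((n.choose (n / 2) : ℝ) * (a + i + 1)) := by positivity
          nlinarith
      _ ≤ _ := by
          refine mul_le_mul hn e3 ?_ (by positivity)
          exact mul_nonneg (by linarith) (by linarith)

/-- Few families have bounded out-degree under strict inclusion. -/
lemma eventually_card_outDegreeLt_le (M : ℕ) {ε : ℝ} (hε : 0 < ε) (hε1 : ε ≤ 1) :
    ∀ᶠ n : ℕ in Filter.atTop,
      (#{F ∈ (range n).powerset.powerset | OutDegreeLt (· ⊂ ·) M F} : ℝ) ≤
        2 ^ ((1 + ε) * (n.choose (n / 2) : ℝ)) := by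
  set η := ε / 8 with hη
  set c := ε / 16 * √(η / 8) with hc
  have hη0 : 0 < η := by positivity
  have hsq : √(η / 8) ≤ 1 := Real.sqrt_le_one.2 (by linarith)
  have hsq0 : 0 < √(η / 8) := by positivity
  obtain ⟨d₀, hd₀, hd⟩ := exists_pow_le_mul_one_add_pow M (c := c) (by positivity) (by nlinarith)
  filter_upwards [eventually_card_largeSets_le (show 0 < ε / 4 by positivity),
    Filter.eventually_ge_atTop 4,
    tendsto_natCast_atTop_atTop.eventually_ge_atTop (d₀ / (η / 8))] with n hlarge hn4 hnd
  rw [div_le_iff₀ (by positivity)] at hnd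
  set N : ℝ := (n.choose (n / 2) : ℝ) with hN
  have hN0 : 0 ≤ N := by positivity
  set V := (range n).powerset \ largeSets n with hV
  set m := n / 4 with hm
  have hm8 : (n : ℝ) / 8 ≤ m := by
    have : n ≤ 8 * m := by omega
    have : (n : ℝ) ≤ 8 * m := by exact_mod_cast this
    linarith
  have hn0 : (0 : ℝ) < n := by exact_mod_cast (by omega : 0 < n)
  set δ := ε / 16 / √n with hδ
  have hδ0 : 0 < δ := by positivity
  have hcount := card_filter_outDegreeLt_le (fun A B : Finset ℕ => A ⊂ B)
    (fun A => ssubset_irrefl A) M (⌊η * m⌋₊ + 1) ⌊(1 + ε / 4) * N⌋₊ (1 + δ) (by linarith)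
    (fun d hdΔ => by
      have hd1 : η * m < d := (Nat.lt_floor_add_one _).trans_le (by exact_mod_cast hdΔ)
      have hd2 : η / 8 * n ≤ d := by nlinarith
      have hdd : d₀ ≤ d := by
        have : (d₀ : ℝ) ≤ d := by linarith
        exact_mod_cast this
      have hcδ : c / √d ≤ δ := by
        have hd0 : (0 : ℝ) < d := by exact_mod_cast hd₀.trans_le hdd
        have h1 : √(η / 8) * √n ≤ √d := by
          rw [← Real.sqrt_mul (by positivity)]
          exact Real.sqrt_le_sqrt hd2
        rw [hc, hδ, mul_div_assoc, div_eq_mul_inv (ε / 16)]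
        gcongr
        rw [div_le_iff₀ (by positivity), inv_mul_eq_div, le_div_iff₀ (by positivity)]
        exact h1
      rw [add_sub_cancel_left]
      refine (hd d hdd).trans ?_
      have hc0 : 0 ≤ c / √(d : ℝ) := by positivity
      gcongr) V
    (fun S hS hSd => by
      refine Nat.le_floor ?_
      have h := card_mul_le_of_outDegree_le_range n m η (by omega) S
        (hS.trans sdiff_subset) (fun A hA => by
          have h1 := mem_sdiff.1 (hS hA)
          have h2 : ¬ 3 * n ≤ 4 * #A := fun h => h1.2 (mem_filter.2 ⟨h1.1, h⟩)
          omega) (fun A hA => by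
          have h1 := Nat.lt_succ_iff.1 (hSd A hA)
          exact (Nat.le_floor_iff (by positivity)).1 h1)
      have h2 : (1 : ℝ) ≤ (1 + ε / 4) * (1 - η) := by nlinarith
      have h3 : (0 : ℝ) ≤ #S := by positivity
      calc (#S : ℝ) ≤ ((1 + ε / 4) * (1 - η)) * #S := by nlinarith
        _ = (1 + ε / 4) * ((1 - η) * #S) := by ring
        _ ≤ (1 + ε / 4) * N := by gcongr)
  have hsplit : #{F ∈ (range n).powerset.powerset | OutDegreeLt (· ⊂ ·) M F} ≤
      2 ^ #(largeSets n) * #{F ∈ V.powerset | OutDegreeLt (· ⊂ ·) M F} := by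
    rw [← card_powerset, ← card_product]
    refine card_le_card_of_injOn (fun F => (F ∩ largeSets n, F \ largeSets n))
      (fun F hF => ?_) fun F _ G _ h => ?_
    · obtain ⟨hF1, hF2⟩ := mem_filter.1 (mem_coe.1 hF)
      refine mem_coe.2 (mem_product.2 ⟨mem_powerset.2 inter_subset_right, mem_filter.2
        ⟨mem_powerset.2 (sdiff_subset_sdiff (mem_powerset.1 hF1) Subset.rfl),
          hF2.mono sdiff_subset⟩⟩)
    · obtain ⟨h1, h2⟩ := Prod.ext_iff.1 h
      simp only at h1 h2
      rw [← sup_inf_sdiff F (largeSets n), ← sup_inf_sdiff G (largeSets n), inf_eq_inter, h1, h2,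
        inf_eq_inter]
  have hVcard : #V ≤ 2 ^ n := by
    calc #V ≤ #(range n).powerset := card_le_card sdiff_subset
      _ = 2 ^ n := by simp
  have hxpow : (1 + δ) ^ #V ≤ 2 ^ (ε / 4 * N) := by
    calc (1 + δ) ^ #V ≤ (1 + δ) ^ (2 ^ n) := pow_le_pow_right₀ (by linarith) hVcard
      _ ≤ Real.exp δ ^ (2 ^ n) := by
          gcongr
          linarith [Real.add_one_le_exp δ]
      _ = Real.exp (2 ^ n * δ) := by rw [← Real.exp_nat_mul]; push_cast; rfl
      _ ≤ Real.exp (ε / 8 * N) := by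
          refine Real.exp_le_exp.2 ?_
          calc 2 ^ n * δ ≤ (2 * √n * N) * δ := by
                gcongr
                exact two_pow_le_sqrt_mul_choose_half (by omega)
            _ = ε / 8 * N := by rw [hδ]; field_simp; ring
      _ ≤ 2 ^ (ε / 4 * N) := by
          rw [Real.rpow_def_of_pos (by norm_num)]
          refine Real.exp_le_exp.2 ?_
          have := Real.log_two_gt_d9
          have : 0 ≤ ε * N := by positivity
          nlinarith
  have hsplit' : (#{F ∈ (range n).powerset.powerset | OutDegreeLt (· ⊂ ·) M F} : ℝ) ≤
      2 ^ #(largeSets n) * #{F ∈ V.powerset | OutDegreeLt (· ⊂ ·) M F} := by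
    exact_mod_cast hsplit
  calc _ ≤ (2 : ℝ) ^ #(largeSets n) *
        (2 ^ ⌊(1 + ε / 4) * N⌋₊ * (1 + δ) ^ #V) := hsplit'.trans (by gcongr)
    _ ≤ 2 ^ (ε / 4 * N) * (2 ^ ((1 + ε / 4) * N) * 2 ^ (ε / 4 * N)) := by
        gcongr
        · rw [← Real.rpow_natCast]
          exact Real.rpow_le_rpow_of_exponent_le (by norm_num) hlarge
        · rw [← Real.rpow_natCast]
          exact Real.rpow_le_rpow_of_exponent_le (by norm_num) (Nat.floor_le (by positivity))
    _ = 2 ^ ((1 + 3 * ε / 4) * N) := by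
        rw [← Real.rpow_add (by norm_num), ← Real.rpow_add (by norm_num)]
        congr 1; ring
    _ ≤ 2 ^ ((1 + ε) * N) := by
        refine Real.rpow_le_rpow_of_exponent_le (by norm_num) ?_
        gcongr
        linarith

/-- For all `t ≥ 1` and `h ≥ 2`, the number of `P_{t,h}`-free families in
`2^[n]` is `2^{(h-1+o(1)) C(n,⌊n/2⌋)}`. -/
theorem stmt_13 (t h : ℕ) (ht : 1 ≤ t) (hh : 2 ≤ h) :
    ∀ ε : ℝ, 0 < ε → ∃ N : ℕ, ∀ n ≥ N,
      (2 : ℝ) ^ (((h : ℝ) - 1 - ε) * (n.choose (n / 2) : ℝ)) ≤ (numPthFree n t h : ℝ) ∧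
      (numPthFree n t h : ℝ) ≤ (2 : ℝ) ^ (((h : ℝ) - 1 + ε) * (n.choose (n / 2) : ℝ)) := by
  intro ε hε
  set H := h - 1 with hH
  have hH0 : 0 < H := by omega
  have hHr : (h : ℝ) - 1 = H := by rw [hH, Nat.cast_sub (by omega)]; simp
  have hHpos : (0 : ℝ) < H := by exact_mod_cast hH0
  have hε' : 0 < ε / H := by positivity
  have hmin : 0 < min (ε / H) 1 := lt_min hε' one_pos
  have hlow : ∀ᶠ n : ℕ in Filter.atTop, ∀ i ∈ range H,
      (1 - ε / H) * (n.choose (n / 2) : ℝ) ≤ n.choose (n / 2 + i) :=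
    (Filter.eventually_all_finset _).2 fun i _ => eventually_choose_half_add_ge i hε'
  obtain ⟨N, hN⟩ := Filter.eventually_atTop.1 (hlow.and
    (eventually_card_outDegreeLt_le #(treeVerts t h) hmin (min_le_right _ _)))
  refine ⟨N, fun n hn => ?_⟩
  obtain ⟨h1, h2⟩ := hN n hn
  rw [hHr]
  constructor
  · have h3 : (2 : ℝ) ^ (∑ i ∈ range H, n.choose (n / 2 + i)) ≤ numPthFree n t h := by
      exact_mod_cast two_pow_le_numPthFree ht
    refine le_trans ?_ h3
    rw [← Real.rpow_natCast]
    refine Real.rpow_le_rpow_of_exponent_le (by norm_num) ?_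
    calc ((H : ℝ) - ε) * (n.choose (n / 2) : ℝ)
        = ∑ i ∈ range H, (1 - ε / H) * (n.choose (n / 2) : ℝ) := by
          rw [sum_const, card_range, nsmul_eq_mul]; field_simp
      _ ≤ ∑ i ∈ range H, (n.choose (n / 2 + i) : ℝ) := sum_le_sum h1
      _ = _ := by push_cast; rfl
  · have h3 : (numPthFree n t h : ℝ) ≤ (#{F ∈ (range n).powerset.powerset |
        OutDegreeLt (· ⊂ ·) #(treeVerts t h) F} : ℝ) ^ H := by
      exact_mod_cast numPthFree_le_pow n t h
    calc (numPthFree n t h : ℝ)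
        ≤ (2 ^ ((1 + min (ε / H) 1) * (n.choose (n / 2) : ℝ))) ^ H := h3.trans (by gcongr)
      _ = 2 ^ ((1 + min (ε / H) 1) * (n.choose (n / 2) : ℝ) * H) := by
          rw [← Real.rpow_natCast, ← Real.rpow_mul (by norm_num)]
      _ ≤ 2 ^ ((1 + ε / H) * (n.choose (n / 2) : ℝ) * H) := by
          refine Real.rpow_le_rpow_of_exponent_le (by norm_num) ?_
          gcongr
          exact min_le_left _ _
      _ = 2 ^ ((H + ε) * (n.choose (n / 2) : ℝ)) := by
          congr 1; field_simp
end
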